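/- arXiv:1902.09814 — 9 statements merged into one kernel-verified Lean document; each statement's English description precedes it below -/
import Mathlib

section
/- Let n ≥ 2 be an integer with n ≢ 5 (mod 6). Then the trinomial G_n(x) = -1 + x + x^n is irreducible over ℚ. -/
open Polynomial

theorem mod_six_eq_five_of_pow_eq_one_sub {n : ℕ} {z : ℂ} (hz : z ^ 2 - z + 1 = 0)
    (hn : z ^ n = 1 - z) : n % 6 = 5 := by
  have h6 : z ^ 6 = 1 := by
    linear_combination (z ^ 4 + z ^ 3 - z - 1) * hz
  rw [← Nat.mod_add_div n 6, pow_add, pow_mul, h6, one_pow, mul_one] at hn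
  have hlt : n % 6 < 6 := Nat.mod_lt n (by norm_num)
  interval_cases n % 6
  · exact absurd (by linear_combination hz - (z - 1) * hn : (1 : ℂ) = 0) one_ne_zero
  · exact absurd (by linear_combination 4 * hz - (2 * z - 1) * hn : (3 : ℂ) = 0) three_ne_zero
  · exact absurd (by linear_combination hz - z / 2 * (hn - hz) : (1 : ℂ) = 0) one_ne_zero
  · exact absurd (by linear_combination hz - (z + 1) * (hn - (z + 1) * hz) : (3 : ℂ) = 0)
      three_ne_zero
  · exact absurd (by linear_combination (z ^ 2 + z) * hz - hn : (1 : ℂ) = 0) one_ne_zero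
  · rfl

theorem irreducible_neg_one_add_X_add_X_pow_int {n : ℕ} (hn : 1 < n) (h : n % 6 ≠ 5) :
    Irreducible (-1 + X + X ^ n : ℤ[X]) := by
  have hp : (-1 + X + X ^ n : ℤ[X]) = trinomial 0 1 n (-1) 1 1 := by
    simp [trinomial]
  rw [hp]
  apply IsUnitTrinomial.irreducible_of_coprime' ⟨0, 1, n, zero_lt_one, hn, -1, 1, 1, rfl⟩
  rintro z ⟨h1, h2⟩
  rw [trinomial_mirror zero_lt_one hn (-1 : ℤˣ).ne_zero (1 : ℤˣ).ne_zero] at h2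
  simp only [trinomial, aeval_add, aeval_mul, aeval_X_pow,
    Units.val_neg, Units.val_one, map_neg, map_one] at h1 h2
  have hpow : z ^ n = z ^ (n - 1) * z := by rw [← pow_succ, Nat.sub_add_cancel hn.le]
  refine h (mod_six_eq_five_of_pow_eq_one_sub (z := z) ?_ (by linear_combination h1))
  simp only [add_zero] at h2
  linear_combination z * h2 + (z - 1) * h1 + hpow

/-- **Selmer.** For `n ≥ 2` with `n ≢ 5 (mod 6)`, the trinomial
`G_n(x) = -1 + x + x^n` is irreducible over `ℚ`. -/
theorem selmer_irreducible (n : ℕ) (hn : 2 ≤ n) (h : n % 6 ≠ 5) :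
    Irreducible (-1 + X + X ^ n : Polynomial ℚ) := by
  have hp : (-1 + X + X ^ n : ℤ[X]) = trinomial 0 1 n (-1) 1 1 := by
    simp [trinomial]
  have hprim : (-1 + X + X ^ n : ℤ[X]).IsPrimitive :=
    hp ▸ (trinomial_monic zero_lt_one hn).isPrimitive
  simpa using (IsPrimitive.Int.irreducible_iff_irreducible_map_cast hprim).mp
    (irreducible_neg_one_add_X_add_X_pow_int hn h)
end

section
/- Let n ≥ 2 be an integer with n ≡ 5 (mod 6). Then the trinomial G_n(x) = -1 + x + x^n factors as the product of exactly two irreducible factors: the cyclotomic polynomial x^2 - x + 1 and the quotient (-1 + x + x^n)/(x^2 - x + 1), which is an irreducible nonreciprocal polynomial of degree n - 2. -/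
open Polynomial

namespace Polynomial

theorem IsUnitTrinomial.eq_or_eq_mirror_of_mul_mirror_eq {p q : ℤ[X]} (hp : p.IsUnitTrinomial)
    (hpq : p * p.mirror = q * q.mirror) :
    q = p ∨ q = -p ∨ q = p.mirror ∨ q = -p.mirror := by
  have hq : IsUnitTrinomial q := (isUnitTrinomial_iff'' hpq).mp hp
  obtain ⟨k, m, n, hkm, hmn, u, v, w, hp⟩ := hp
  obtain ⟨k', m', n', hkm', hmn', x, y, z, hq⟩ := hq
  have hk : k = k' := by
    rw [← mul_right_inj' (show 2 ≠ 0 from two_ne_zero), ←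
      trinomial_natTrailingDegree hkm hmn u.ne_zero, ← hp, ← natTrailingDegree_mul_mirror, hpq,
      natTrailingDegree_mul_mirror, hq, trinomial_natTrailingDegree hkm' hmn' x.ne_zero]
  have hn : n = n' := by
    rw [← mul_right_inj' (show 2 ≠ 0 from two_ne_zero), ← trinomial_natDegree hkm hmn w.ne_zero, ←
      hp, ← natDegree_mul_mirror, hpq, natDegree_mul_mirror, hq,
      trinomial_natDegree hkm' hmn' z.ne_zero]
  subst hk
  subst hn
  rcases eq_or_eq_neg_of_sq_eq_sq (y : ℤ) (v : ℤ)
      ((Int.isUnit_sq y.isUnit).trans (Int.isUnit_sq v.isUnit).symm) with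
    (h1 | h1)
  · rw [h1] at hq
    rcases irreducible_aux3 hkm hmn hkm' hmn' u v w x z hp hq hpq with (h2 | h2)
    · exact Or.inl h2
    · exact Or.inr (Or.inr (Or.inl h2))
  · rw [h1] at hq
    rw [trinomial_def] at hp
    rw [← neg_inj, neg_add, neg_add, ← neg_mul, ← neg_mul, ← neg_mul, ← C_neg, ← C_neg, ← C_neg]
      at hp
    rw [← neg_mul_neg, ← mirror_neg] at hpq
    rcases irreducible_aux3 hkm hmn hkm' hmn' (-u) (-v) (-w) x z hp hq hpq with (rfl | rfl)
    · exact Or.inr (Or.inl rfl)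
    · exact Or.inr (Or.inr (Or.inr p.mirror_neg))

/-- In a factorization `c * a * b` of a unit trinomial with `c` self-mirror, one of the factors
`a`, `b` divides its own mirror. -/
theorem IsUnitTrinomial.dvd_mirror_or_dvd_mirror {a b c : ℤ[X]}
    (hp : (c * a * b).IsUnitTrinomial) (hc : c.mirror = c) :
    a ∣ a.mirror ∨ b ∣ b.mirror := by
  have h0 := hp.ne_zero
  have hca : c * a ≠ 0 := left_ne_zero_of_mul h0
  have hcb : c * b.mirror ≠ 0 :=
    mul_ne_zero (left_ne_zero_of_mul hca) (mt mirror_eq_zero.mp (right_ne_zero_of_mul h0))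
  have key := hp.eq_or_eq_mirror_of_mul_mirror_eq (q := c * a * b.mirror) (by
    simp only [mirror_mul_of_domain, mirror_mirror, hc]; ring)
  simp only [mirror_mul_of_domain, hc] at key
  rcases key with h | h | h | h
  · exact .inr (mul_left_cancel₀ hca h).symm.dvd
  · refine .inr ⟨-1, mul_left_cancel₀ hca ?_⟩
    linear_combination h
  · refine .inl (mul_left_cancel₀ hcb ?_ : a = a.mirror).dvd
    linear_combination h
  · refine .inl ⟨-1, mul_left_cancel₀ hcb ?_⟩
    linear_combination h

end Polynomial

theorem exists_aeval_complex_eq_zero_of_not_isUnit {d : ℤ[X]} (hd : IsUnit d.leadingCoeff)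
    (hu : ¬IsUnit d) : ∃ z : ℂ, aeval z d = 0 := by
  apply IsAlgClosed.exists_aeval_eq_zero_of_injective ℂ (RingHom.injective_int _)
  intro h
  rw [eq_C_of_degree_eq_zero h] at hd hu
  rw [leadingCoeff_C] at hd
  exact hu (hd.map C)

theorem selmer_trinomial_eq (n : ℕ) :
    (-1 + X + X ^ n : ℤ[X]) = trinomial 0 1 n ((-1 : ℤˣ) : ℤ) (1 : ℤˣ) (1 : ℤˣ) := by
  simp [trinomial]

theorem selmer_isUnitTrinomial {n : ℕ} (hn : 1 < n) : (-1 + X + X ^ n : ℤ[X]).IsUnitTrinomial :=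
  ⟨0, 1, n, zero_lt_one, hn, -1, 1, 1, selmer_trinomial_eq n⟩

theorem selmer_monic {n : ℕ} (hn : 1 < n) : (-1 + X + X ^ n : ℤ[X]).Monic := by
  rw [selmer_trinomial_eq]
  exact trinomial_monic zero_lt_one hn

theorem mirror_X_sq_sub_X_add_one : (X ^ 2 - X + 1 : ℤ[X]).mirror = X ^ 2 - X + 1 := by
  have h : (X ^ 2 - X + 1 : ℤ[X]) = trinomial 0 1 2 1 (-1) 1 := by
    simp only [trinomial, C_neg, C_1]; ring
  rw [h, trinomial_mirror zero_lt_one one_lt_two one_ne_zero one_ne_zero]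
  rfl

theorem X_sq_sub_X_add_one_dvd_selmer {n : ℕ} (h : n % 6 = 5) :
    (X ^ 2 - X + 1 : ℤ[X]) ∣ -1 + X + X ^ n := by
  obtain ⟨r, hr⟩ := sub_one_dvd_pow_sub_one (X ^ 6 : ℤ[X]) (n / 6)
  have hX : (X ^ n : ℤ[X]) = X ^ 5 * (X ^ 6) ^ (n / 6) := by
    rw [← pow_mul, ← pow_add]; congr 1; omega
  refine ⟨X ^ 3 + X ^ 2 - 1 + X ^ 5 * (X + 1) * (X ^ 3 - 1) * r, ?_⟩
  rw [hX]
  linear_combination X ^ 5 * hr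

theorem irreducible_X_sq_sub_X_add_one : Irreducible (X ^ 2 - X + 1 : ℚ[X]) := by
  rw [← cyclotomic_six]
  exact cyclotomic.irreducible_rat (by norm_num)

/-- The cofactor of `X ^ 2 - X + 1` in `-1 + X + X ^ n` has no nontrivial divisor dividing its own
mirror. -/
theorem isUnit_of_dvd_mirror_of_dvd_selmer_cofactor {n : ℕ} (hn : 1 < n) {Q d : ℤ[X]}
    (hQ : (-1 + X + X ^ n : ℤ[X]) = (X ^ 2 - X + 1) * Q) (hdQ : d ∣ Q) (hd : d ∣ d.mirror) :
    IsUnit d := by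
  have hdp : d ∣ -1 + X + X ^ n := hQ ▸ hdQ.mul_left _
  by_contra hu
  obtain ⟨z, hz⟩ : ∃ z : ℂ, aeval z d = 0 := by
    refine exists_aeval_complex_eq_zero_of_not_isUnit ?_ hu
    exact isUnit_of_dvd_one ((selmer_monic hn).leadingCoeff ▸ leadingCoeff_dvd_leadingCoeff hdp)
  have root_of_dvd {f : ℤ[X]} (hf : d ∣ f) : aeval z f = 0 := by
    obtain ⟨e, rfl⟩ := hf
    rw [map_mul, hz, zero_mul]
  have hdm : d ∣ (-1 + X + X ^ n : ℤ[X]).mirror := by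
    obtain ⟨e, he⟩ := hdp
    rw [he, mirror_mul_of_domain]
    exact hd.mul_right _
  have h1 : z ^ n = 1 - z := by
    have := root_of_dvd hdp
    simp only [map_add, map_neg, map_one, map_pow, aeval_X] at this
    linear_combination this
  have h2 := root_of_dvd hdm
  rw [selmer_trinomial_eq, trinomial_mirror zero_lt_one hn (-1 : ℤˣ).ne_zero (1 : ℤˣ).ne_zero]
    at h2
  simp only [trinomial, Units.val_neg, Units.val_one, map_add, map_mul, map_neg, map_one, map_pow,
    aeval_X, add_zero, pow_zero, mul_one, one_mul] at h2
  have hs : z ^ (n - 1) * z = z ^ n := by rw [← pow_succ, Nat.sub_add_cancel hn.le]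
  have h3 : z ^ 2 - z + 1 = 0 := by
    linear_combination z * h2 - hs + (z - 1) * h1
  have h4 : (n : ℂ) * z ^ (n - 1) + 1 = 0 := by
    have := congr_arg (fun f => aeval z (derivative f)) hQ
    simp only [derivative_mul, map_neg, derivative_one,
      derivative_X, derivative_X_pow, map_add, map_mul, map_sub, map_pow, map_one, aeval_X,
      map_natCast, map_zero, root_of_dvd hdQ, h3] at this
    linear_combination this
  have h5 : (n : ℂ) ^ 2 - n + 1 = 0 := by
    have h6 : (n - 1 : ℂ) * z = n := by
      linear_combination n * h1 + n * hs - z * h4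
    linear_combination (n - 1 : ℂ) ^ 2 * h3 - ((n - 1 : ℂ) * z + n - (n - 1)) * h6
  have h7 : (n : ℤ) ^ 2 - n + 1 = 0 := by exact_mod_cast h5
  nlinarith

theorem irreducible_selmer_cofactor {n : ℕ} (hn : 1 < n) {Q : ℤ[X]}
    (hQ : (-1 + X + X ^ n : ℤ[X]) = (X ^ 2 - X + 1) * Q) (hQu : ¬IsUnit Q) : Irreducible Q := by
  refine ⟨hQu, fun a b hab => ?_⟩
  have hp := selmer_isUnitTrinomial hn
  rw [hQ, hab, ← mul_assoc] at hp
  refine (hp.dvd_mirror_or_dvd_mirror mirror_X_sq_sub_X_add_one).imp (fun h => ?_) (fun h => ?_)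
  · exact isUnit_of_dvd_mirror_of_dvd_selmer_cofactor hn hQ (hab ▸ dvd_mul_right a b) h
  · exact isUnit_of_dvd_mirror_of_dvd_selmer_cofactor hn hQ (hab ▸ dvd_mul_left b a) h

/-- **Selmer.** For `n ≥ 2` with `n ≡ 5 (mod 6)`, the trinomial
`G_n(x) = -1 + x + x^n` factors as the product of two irreducible factors:
the cyclotomic polynomial `x^2 - x + 1` and an irreducible nonreciprocal
polynomial of degree `n - 2`. -/
theorem selmer_reducible (n : ℕ) (hn : 2 ≤ n) (h : n % 6 = 5) :
    ∃ Q : Polynomial ℚ,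
      (-1 + X + X ^ n : Polynomial ℚ) = (X ^ 2 - X + 1) * Q ∧
      Irreducible (X ^ 2 - X + 1 : Polynomial ℚ) ∧
      Irreducible Q ∧
      Q.natDegree = n - 2 ∧
      Q.reverse ≠ Q := by
  obtain ⟨Q, hQ⟩ := X_sq_sub_X_add_one_dvd_selmer h
  have hn1 : 1 < n := by omega
  have hΦ : (X ^ 2 - X + 1 : ℤ[X]).Monic := by monicity!
  have hΦd : (X ^ 2 - X + 1 : ℤ[X]).natDegree = 2 := by compute_degree!
  have hQm : Q.Monic := hΦ.of_mul_monic_left (hQ ▸ selmer_monic hn1)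
  have hd : Q.natDegree = n - 2 := by
    have := congr_arg natDegree hQ
    rw [hΦ.natDegree_mul hQm, hΦd, selmer_trinomial_eq,
      trinomial_natDegree zero_lt_one hn1 (1 : ℤˣ).ne_zero] at this
    omega
  have hQ0 : Q.coeff 0 = -1 := by
    have := congr_arg (eval 0) hQ
    simp [show n ≠ 0 by omega] at this
    rw [coeff_zero_eq_eval_zero, ← this]
  have hirr : Irreducible Q := by
    refine irreducible_selmer_cofactor hn1 hQ fun hu => ?_
    have := natDegree_eq_zero_of_isUnit hu
    omega
  refine ⟨Q.map (Int.castRingHom ℚ), ?_, irreducible_X_sq_sub_X_add_one,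
    (IsPrimitive.Int.irreducible_iff_irreducible_map_cast hQm.isPrimitive).mp hirr, ?_, fun hr => ?_⟩
  · simpa using congr_arg (map (Int.castRingHom ℚ)) hQ
  · rw [hQm.natDegree_map, hd]
  · have := congr_arg (coeff · 0) hr
    simp only [coeff_zero_reverse, (hQm.map _).leadingCoeff, coeff_map, hQ0] at this
    norm_num at this
end

section
/- Let f(x) = -1 + x + x^n + x^{m_1} be a quadrinomial in the class B (so n ≥ 3 and m_1 - n ≥ n - 1). If f has no root which is a root of unity, then f is irreducible over ℚ. If f has exactly q roots which are roots of unity, then f is the product of two nonconstant rational factors, one of which is a product of cyclotomic polynomials of total degree q having exactly these roots of unity as zeroes, while the other factor is irreducible and nonreciprocal. -/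
open Polynomial

/-- The quadrinomial `f(x) = -1 + x + x^n + x^{m₁}` of the class `B`. -/
noncomputable def quad (n m : ℕ) : Polynomial ℚ := -1 + X + X ^ n + X ^ m

/-- The quadrinomial `quad n m` with integer coefficients. -/
noncomputable def quadZ (n m : ℕ) : ℤ[X] := -1 + X + X ^ n + X ^ m

lemma coeff_mul_rev (a b m d : ℕ) (ha : 0 < a) (hab : a < b) (hb : b < m) (hd : 0 < d) :
    ((-1 + X ^ a + X ^ b + X ^ m : ℤ[X]) *
      (1 + X ^ (m - b) + X ^ (m - a) - X ^ m)).coeff (m + d) =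
    - (if d = a then 1 else 0) - (if d = b then 1 else 0) - (if d = m then 1 else 0)
    + (if d = b - a then 1 else 0) + (if d = m - a then 1 else 0)
    + (if d = m - b then 1 else 0) := by
  have h : ((-1 + X ^ a + X ^ b + X ^ m : ℤ[X]) *
      (1 + X ^ (m - b) + X ^ (m - a) - X ^ m)) =
      X ^ (b + (m - a)) + X ^ (m + (m - b)) + X ^ (m + (m - a)) - X ^ (a + m) - X ^ (b + m)
      - X ^ (m + m) + X ^ (a + (m - a)) + X ^ (b + (m - b)) + X ^ (a + (m - b)) + X ^ a + X ^ b
      + X ^ m + X ^ m - X ^ (m - b) - X ^ (m - a) - 1 := by ring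
  rw [h]
  simp only [coeff_add, coeff_sub, coeff_X_pow, coeff_one]
  clear h
  grind (splits := 20)

lemma eq_of_mul_rev_eq {n m a b : ℕ} (hn : 3 ≤ n) (hm : n + (n - 1) ≤ m)
    (ha : 0 < a) (hab : a < b) (hb : b < m)
    (h : (-1 + X ^ a + X ^ b + X ^ m : ℤ[X]) * (1 + X ^ (m - b) + X ^ (m - a) - X ^ m) =
      (-1 + X ^ 1 + X ^ n + X ^ m) * (1 + X ^ (m - n) + X ^ (m - 1) - X ^ m)) :
    a = 1 ∧ b = n := by
  have key : ∀ d, 0 < d → _ := fun d hd =>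
    (coeff_mul_rev a b m d ha hab hb hd).symm.trans
      ((congrArg (coeff · (m + d)) h).trans
        (coeff_mul_rev 1 n m d one_pos (by omega) (by omega) hd))
  clear h
  have h1 := key 1 one_pos
  have ha1 : a = 1 := by grind (splits := 20)
  subst ha1
  have h2 := key n (by omega)
  have h3 := key b (by omega)
  clear key
  grind (splits := 20)

lemma mirror_quad (a b m : ℕ) (hab : a ≤ m) (hb : b ≤ m) (c₀ ca cb cm : ℤ)
    (g : ℤ[X]) (hg : g = C c₀ + C ca * X ^ a + C cb * X ^ b + C cm * X ^ m)
    (hd : g.natDegree = m) (ht : g.natTrailingDegree = 0) :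
    g.mirror = C cm + C cb * X ^ (m - b) + C ca * X ^ (m - a) + C c₀ * X ^ m := by
  ext d
  rw [coeff_mirror, hd, ht, hg]
  simp only [coeff_add, coeff_C_mul, coeff_X_pow, coeff_C, add_zero, mul_ite, mul_one, mul_zero]
  by_cases h : d ≤ m
  · rw [revAt_le h]
    grind (splits := 20)
  · rw [revAt_eq_self_of_lt (by omega)]
    grind (splits := 20)

lemma quadZ_coeff (n m k : ℕ) : (quadZ n m).coeff k = -(if k = 0 then 1 else 0)
    + (if k = 1 then 1 else 0) + (if k = n then 1 else 0) + (if k = m then 1 else 0) := by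
  simp [quadZ, coeff_X, coeff_one, coeff_X_pow, eq_comm]

lemma quadZ_natDegree {n m : ℕ} (hn : 1 < n) (hm : n < m) : (quadZ n m).natDegree = m := by
  refine natDegree_eq_of_le_of_coeff_ne_zero ?_ ?_
  · rw [natDegree_le_iff_coeff_eq_zero]
    intro k hk
    rw [quadZ_coeff]
    grind
  · rw [quadZ_coeff]
    grind

lemma quadZ_monic {n m : ℕ} (hn : 1 < n) (hm : n < m) : (quadZ n m).Monic := by
  rw [Monic, leadingCoeff, quadZ_natDegree hn hm, quadZ_coeff]
  grind

lemma quadZ_coeff_zero {n m : ℕ} (hn : 1 < n) (hm : n < m) : (quadZ n m).coeff 0 = -1 := by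
  rw [quadZ_coeff]
  grind

lemma quadZ_natTrailingDegree {n m : ℕ} (hn : 1 < n) (hm : n < m) :
    (quadZ n m).natTrailingDegree = 0 :=
  natTrailingDegree_eq_zero.2 (.inr (by rw [quadZ_coeff_zero hn hm]; simp))

lemma quadZ_sum_sq {n m : ℕ} (hn : 1 < n) (hm : n < m) :
    ((quadZ n m).sum fun _ c => c ^ 2) = 4 := by
  rw [Polynomial.sum_def, Finset.sum_subset (s₂ := {0, 1, n, m})]
  · have h : ∀ k ∈ ({0, 1, n, m} : Finset ℕ), (quadZ n m).coeff k ^ 2 = 1 := by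
      intro k hk
      rw [quadZ_coeff]
      simp only [Finset.mem_insert, Finset.mem_singleton] at hk
      grind
    rw [Finset.sum_congr rfl h]
    simp
    grind
  · intro k hk
    rw [mem_support_iff, quadZ_coeff] at hk
    simp only [Finset.mem_insert, Finset.mem_singleton]
    grind
  · intro k _ hk
    simp [notMem_support_iff.1 hk]

lemma quadZ_mirror {n m : ℕ} (hn : 1 < n) (hm : n < m) :
    (quadZ n m).mirror = 1 + X ^ (m - n) + X ^ (m - 1) - X ^ m := by
  rw [mirror_quad 1 n m (by omega) hm.le (-1) 1 1 1 _ (by simp [quadZ])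
    (quadZ_natDegree hn hm) (quadZ_natTrailingDegree hn hm)]
  simp
  ring

/-- Nonzero integers whose squares sum to two are exactly two units. -/
lemma exists_pair_of_sum_sq_eq_two {s : Finset ℕ} {c : ℕ → ℤ} (hc : ∀ k ∈ s, c k ≠ 0)
    (h : ∑ k ∈ s, c k ^ 2 = 2) :
    ∃ a b, a < b ∧ s = {a, b} ∧ c a ^ 2 = 1 ∧ c b ^ 2 = 1 := by
  have h1 : ∀ k ∈ s, 1 ≤ c k ^ 2 := fun k hk => by
    have := hc k hk
    have := sq_pos_of_ne_zero this
    omega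
  have hcard : (s.card : ℤ) ≤ 2 := by
    rw [← h]
    simpa using Finset.sum_le_sum h1
  have hcard' : s.card = 0 ∨ s.card = 1 ∨ s.card = 2 := by omega
  rcases hcard' with h0 | h0 | h0
  · rw [Finset.card_eq_zero] at h0
    simp [h0] at h
  · obtain ⟨a, rfl⟩ := Finset.card_eq_one.1 h0
    rw [Finset.sum_singleton] at h
    have h2 : c a < 2 := by nlinarith
    have h3 : -2 < c a := by nlinarith
    interval_cases c a <;> omega
  · obtain ⟨a, b, hab, rfl⟩ := Finset.card_eq_two.1 h0
    rw [Finset.sum_pair hab] at h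
    have ha := h1 a (by simp)
    have hb := h1 b (by simp)
    rcases hab.lt_or_gt with hab | hab
    · exact ⟨a, b, hab, rfl, by omega, by omega⟩
    · exact ⟨b, a, hab, Finset.pair_comm _ _, by omega, by omega⟩

lemma eq_of_mul_mirror_eq {n m : ℕ} (hn : 3 ≤ n) (hm : n + (n - 1) ≤ m) {g : ℤ[X]}
    (h : quadZ n m * (quadZ n m).mirror = g * g.mirror) :
    g = quadZ n m ∨ g = -quadZ n m ∨ g = (quadZ n m).mirror ∨ g = -(quadZ n m).mirror := by
  have hn' : 1 < n := by omega
  have hm' : n < m := by omega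
  have hd : g.natDegree = m := by
    have := congrArg natDegree h
    rw [natDegree_mul_mirror, natDegree_mul_mirror, quadZ_natDegree hn' hm'] at this
    omega
  have ht : g.natTrailingDegree = 0 := by
    have := congrArg natTrailingDegree h
    rw [natTrailingDegree_mul_mirror, natTrailingDegree_mul_mirror,
      quadZ_natTrailingDegree hn' hm'] at this
    omega
  have hlt : g.coeff m * g.coeff 0 = -1 := by
    have := congrArg leadingCoeff h
    rw [leadingCoeff_mul, leadingCoeff_mul, mirror_leadingCoeff, mirror_leadingCoeff,
      trailingCoeff, trailingCoeff, ht, quadZ_natTrailingDegree hn' hm', quadZ_monic hn' hm',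
      quadZ_coeff_zero hn' hm', leadingCoeff, hd] at this
    omega
  have hsum : ∑ k ∈ g.support, g.coeff k ^ 2 = 4 := by
    have h1 := (quadZ n m).coeff_mul_mirror
    have h2 := g.coeff_mul_mirror
    rw [quadZ_natDegree hn' hm', quadZ_natTrailingDegree hn' hm', h] at h1
    rw [hd, ht] at h2
    rw [← quadZ_sum_sq hn' hm']
    exact h2.symm.trans h1
  have hone : g.eval 1 ^ 2 = 4 := by
    have := congrArg (eval 1) h
    rw [eval_mul, eval_mul, mirror_eval_one, mirror_eval_one] at this
    simp [quadZ] at this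
    linarith
  have hu := Int.eq_one_or_neg_one_of_mul_eq_neg_one' hlt
  have h0 : 0 ∈ g.support := by rw [mem_support_iff]; rintro h; simp [h] at hlt
  have hmm : m ∈ g.support := by rw [mem_support_iff]; rintro h; simp [h] at hlt
  have hm0 : m ∈ g.support.erase 0 := Finset.mem_erase.2 ⟨by omega, hmm⟩
  rw [← Finset.add_sum_erase _ _ h0, ← Finset.add_sum_erase _ _ hm0] at hsum
  obtain ⟨a, b, hab, hs, ha1, hb1⟩ := exists_pair_of_sum_sq_eq_two
    (s := (g.support.erase 0).erase m) (c := g.coeff)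
    (fun k hk => mem_support_iff.1 (Finset.mem_of_mem_erase (Finset.mem_of_mem_erase hk)))
    (by rcases hu with ⟨h1, h2⟩ | ⟨h1, h2⟩ <;> rw [h1, h2] at hsum <;> linarith)
  have hg : g = C (g.coeff 0) + C (g.coeff a) * X ^ a + C (g.coeff b) * X ^ b
      + C (g.coeff m) * X ^ m := by
    conv_lhs => rw [g.as_sum_support_C_mul_X_pow]
    rw [← Finset.add_sum_erase _ _ h0, ← Finset.add_sum_erase _ _ hm0, hs,
      Finset.sum_pair hab.ne]
    ring
  have hmema : a ∈ (g.support.erase 0).erase m := by rw [hs]; simp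
  have hmemb : b ∈ (g.support.erase 0).erase m := by rw [hs]; simp
  simp only [Finset.mem_erase] at hmema hmemb
  have hbm : b < m := by
    have := le_natDegree_of_mem_supp _ hmemb.2.2
    omega
  have hmir := mirror_quad a b m (by omega) hbm.le _ _ _ _ _ hg hd ht
  have hev : g.eval 1 = g.coeff 0 + g.coeff a + g.coeff b + g.coeff m := by
    conv_lhs => rw [hg]
    simp
  have hab' : (g.coeff a = 1 ∧ g.coeff b = 1) ∨ (g.coeff a = -1 ∧ g.coeff b = -1) := by
    rw [hev] at hone
    rcases hu with ⟨h1, h2⟩ | ⟨h1, h2⟩ <;>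
    rcases sq_eq_one_iff.1 ha1 with h3 | h3 <;>
    rcases sq_eq_one_iff.1 hb1 with h4 | h4 <;>
      rw [h1, h2, h3, h4] at hone <;> norm_num at hone <;> simp [h3, h4]
  rw [quadZ_mirror hn' hm', hmir] at h
  have hma := Nat.sub_sub_self (n := m) (m := a) (by omega)
  have hmb := Nat.sub_sub_self (n := m) (m := b) hbm.le
  rcases hu with ⟨h1, h2⟩ | ⟨h1, h2⟩ <;> rcases hab' with ⟨h3, h4⟩ | ⟨h3, h4⟩ <;>
    rw [h1, h2, h3, h4] at h hg <;> rw [hg] at h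
  · obtain ⟨rfl, rfl⟩ := eq_of_mul_rev_eq hn hm (by omega) hab hbm (by
      simp [quadZ] at h ⊢
      linear_combination -h)
    left
    simpa [quadZ] using hg
  · obtain ⟨ha, hb⟩ := eq_of_mul_rev_eq hn hm (a := m - b) (b := m - a) (by omega) (by omega)
      (by omega) (by
      simp [quadZ] at h ⊢
      rw [hma, hmb]
      linear_combination -h)
    right; right; right
    obtain rfl : b = m - 1 := by omega
    obtain rfl : a = m - n := by omega
    rw [quadZ_mirror hn' hm', hg]
    simp
    ring
  · obtain ⟨ha, hb⟩ := eq_of_mul_rev_eq hn hm (a := m - b) (b := m - a) (by omega) (by omega)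
      (by omega) (by
      simp [quadZ] at h ⊢
      rw [hma, hmb]
      linear_combination -h)
    right; right; left
    obtain rfl : b = m - 1 := by omega
    obtain rfl : a = m - n := by omega
    rw [quadZ_mirror hn' hm', hg]
    simp
    ring
  · obtain ⟨rfl, rfl⟩ := eq_of_mul_rev_eq hn hm (by omega) hab hbm (by
      simp [quadZ] at h ⊢
      linear_combination -h)
    right; left
    rw [hg]
    simp [quadZ]
    ring

lemma aeval_quadZ (n m : ℕ) (z : ℂ) : aeval z (quadZ n m) = -1 + z + z ^ n + z ^ m := by
  simp [quadZ]

lemma map_quadZ (n m : ℕ) : (quadZ n m).map (Int.castRingHom ℚ) = quad n m := by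
  simp [quadZ, quad]

lemma exists_pow_eq_one_of_aeval_mirror {n m : ℕ} (hn : 1 < n) (hm : n < m) {z : ℂ}
    (h : aeval z (quadZ n m) = 0) (h' : aeval z (quadZ n m).mirror = 0) :
    ∃ k, 0 < k ∧ z ^ k = 1 := by
  rw [aeval_quadZ] at h
  rw [quadZ_mirror hn hm] at h'
  simp only [map_sub, map_add, map_one, map_pow, aeval_X] at h'
  obtain ⟨c, rfl⟩ := Nat.exists_eq_add_of_le hm.le
  rw [show n + c - n = c by omega] at h'
  have h1 : z ^ (n + c) = z * z ^ (n + c - 1) := by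
    rw [← pow_succ']
    congr 1
    omega
  have key : (1 - z) * ((1 - z ^ n) * (1 - z ^ (n + c))) = 0 := by
    linear_combination -h + z ^ n * z * h' + z ^ n * h1
      + z * (pow_add z n c)
  rcases mul_eq_zero.1 key with h2 | h2
  · exact ⟨1, one_pos, by linear_combination -h2⟩
  rcases mul_eq_zero.1 h2 with h2 | h2
  · exact ⟨n, by omega, by linear_combination -h2⟩
  · exact ⟨n + c, by omega, by linear_combination -h2⟩

lemma isUnit_of_dvd_monic_of_aeval_ne_zero {p f : ℤ[X]} (hf : f.Monic) (h : p ∣ f)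
    (hp : ∀ z : ℂ, aeval z p ≠ 0) : IsUnit p := by
  have hl := hf.isUnit_leadingCoeff_of_dvd h
  have hd : (p.map (algebraMap ℤ ℂ)).degree = 0 := by
    by_contra hd
    obtain ⟨z, hz⟩ := Complex.isAlgClosed.exists_root _ hd
    exact hp z (by rwa [IsRoot, eval_map_algebraMap] at hz)
  rw [degree_map_eq_of_injective (algebraMap ℤ ℂ).injective_int] at hd
  rw [eq_C_of_degree_eq_zero hd] at hl ⊢
  rw [leadingCoeff_C] at hl
  exact hl.map C

lemma exists_cyclotomic_mul (f : ℤ[X]) (hf : f.Monic) :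
    ∃ (l : Multiset ℕ) (B : ℤ[X]), (∀ k ∈ l, 0 < k) ∧
      f = (l.map (fun k => cyclotomic k ℤ)).prod * B ∧
      ∀ z : ℂ, aeval z B = 0 → ¬ ∃ k : ℕ, 0 < k ∧ z ^ k = 1 := by
  induction hd : f.natDegree using Nat.strong_induction_on generalizing f with
  | _ d ih =>
    by_cases h : ∀ z : ℂ, aeval z f = 0 → ¬ ∃ k : ℕ, 0 < k ∧ z ^ k = 1
    · exact ⟨0, f, by simp, by simp, h⟩
    · push Not at h
      obtain ⟨z, hz, k, hk, hzk⟩ := h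
      have ho : 0 < orderOf z := orderOf_pos_iff.2 (isOfFinOrder_iff_pow_eq_one.2 ⟨k, hk, hzk⟩)
      have hprim := IsPrimitiveRoot.orderOf z
      obtain ⟨g, rfl⟩ : cyclotomic (orderOf z) ℤ ∣ f := by
        rw [cyclotomic_eq_minpoly hprim ho]
        exact minpoly.isIntegrallyClosed_dvd (hprim.isIntegral ho) hz
      have hg : g.Monic := (cyclotomic.monic _ _).of_mul_monic_left hf
      obtain ⟨l, B, hl, rfl, hB⟩ := ih g.natDegree (by
        rw [← hd, (cyclotomic.monic _ _).natDegree_mul hg, natDegree_cyclotomic]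
        have := Nat.totient_pos.2 ho
        omega) g hg rfl
      refine ⟨orderOf z ::ₘ l, B, ?_, ?_, hB⟩
      · exact Multiset.forall_mem_cons.2 ⟨ho, hl⟩
      · simp [mul_assoc]

lemma exists_pow_eq_one_of_aeval_cyclotomic_prod {l : Multiset ℕ} (hl : ∀ k ∈ l, 0 < k) {z : ℂ}
    (h : aeval z (l.map (fun k => cyclotomic k ℤ)).prod = 0) : ∃ k, 0 < k ∧ z ^ k = 1 := by
  rw [map_multiset_prod, Multiset.prod_eq_zero_iff] at h
  simp only [Multiset.map_map, Multiset.mem_map, Function.comp] at h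
  obtain ⟨k, hk, h⟩ := h
  refine ⟨k, hl k hk, ?_⟩
  have : NeZero k := ⟨(hl k hk).ne'⟩
  rw [← eval_map_algebraMap, map_cyclotomic, ← IsRoot, isRoot_cyclotomic_iff_charZero (hl k hk)]
    at h
  exact h.pow_eq_one

lemma exists_root_quadZ_not_root_of_unity {n m : ℕ} (hn : 1 < n) (hm : n < m) :
    ∃ z : ℂ, aeval z (quadZ n m) = 0 ∧ ¬ ∃ k : ℕ, 0 < k ∧ z ^ k = 1 := by
  have hc : ContinuousOn (fun x : ℝ => -1 + x + x ^ n + x ^ m) (Set.Icc 0 1) := by fun_prop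
  obtain ⟨x, ⟨hx0, hx1⟩, hx⟩ := intermediate_value_Ioo zero_le_one hc
    (show (0 : ℝ) ∈ _ by simp [show n ≠ 0 by omega, show m ≠ 0 by omega])
  refine ⟨x, ?_, ?_⟩
  · rw [aeval_quadZ]
    exact_mod_cast hx
  · rintro ⟨k, hk, h⟩
    have h' : x ^ k = 1 := by exact_mod_cast h
    exact (pow_lt_one₀ hx0.le hx1 hk.ne').ne h'

section Factor

variable {n m : ℕ} {A B : ℤ[X]}

lemma isUnit_of_dvd_of_dvd_mirror (hn : 1 < n) (hm : n < m) (hAB : quadZ n m = A * B)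
    (hB : ∀ z : ℂ, aeval z B = 0 → ¬ ∃ k : ℕ, 0 < k ∧ z ^ k = 1) {p : ℤ[X]}
    (hp : p ∣ B) (hp' : p ∣ (quadZ n m).mirror) : IsUnit p := by
  have hpf : p ∣ quadZ n m := hAB ▸ hp.mul_left A
  refine isUnit_of_dvd_monic_of_aeval_ne_zero (quadZ_monic hn hm) hpf fun z hz => ?_
  have aux : ∀ {q : ℤ[X]}, p ∣ q → aeval z q = 0 := by
    rintro _ ⟨r, rfl⟩
    rw [map_mul, hz, zero_mul]
  exact hB z (aux hp) (exists_pow_eq_one_of_aeval_mirror hn hm (aux hpf) (aux hp'))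

lemma irreducible_cofactor (hn : 3 ≤ n) (hm : n + (n - 1) ≤ m) (hAB : quadZ n m = A * B)
    (hB : ∀ z : ℂ, aeval z B = 0 → ¬ ∃ k : ℕ, 0 < k ∧ z ^ k = 1)
    (hB' : ¬ IsUnit B) : Irreducible B := by
  have hn' : 1 < n := by omega
  have hm' : n < m := by omega
  have hf : quadZ n m ≠ 0 := (quadZ_monic hn' hm').ne_zero
  refine ⟨hB', fun c d hcd => ?_⟩
  subst hcd
  have hc0 : c ≠ 0 := by rintro rfl; simp at hAB; exact hf hAB
  have hA0 : A ≠ 0 := by rintro rfl; simp at hAB; exact hf hAB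
  have hd0 : d ≠ 0 := by rintro rfl; simp at hAB; exact hf hAB
  have hfm : (quadZ n m).mirror = A.mirror * (c.mirror * d.mirror) := by
    rw [hAB, mirror_mul_of_domain, mirror_mul_of_domain]
  have hunit := fun {p : ℤ[X]} => isUnit_of_dvd_of_dvd_mirror (p := p) hn' hm' hAB hB
  have hd : d ∣ d.mirror → IsUnit d := fun h => hunit (Dvd.intro_left _ rfl) <| by
    rw [hfm]
    exact (h.mul_left _).mul_left _
  have hc : c ∣ A.mirror * c.mirror → IsUnit c := fun h => hunit (Dvd.intro _ rfl) <| by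
    rw [hfm, ← mul_assoc]
    exact h.mul_right _
  have key : quadZ n m * (quadZ n m).mirror = (A * c * d.mirror) * (A * c * d.mirror).mirror := by
    rw [hfm, hAB]
    simp only [mirror_mul_of_domain, mirror_mirror]
    ring
  have hAc : A * c ≠ 0 := mul_ne_zero hA0 hc0
  have hdm : d.mirror ≠ 0 := by simpa using hd0
  rcases eq_of_mul_mirror_eq hn hm key with h | h | h | h
  · right
    refine hd (dvd_of_eq (mul_left_cancel₀ hAc ?_))
    linear_combination -hAB - h
  · right
    refine hd ((dvd_neg.2 dvd_rfl).trans (dvd_of_eq (mul_left_cancel₀ hAc ?_)))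
    linear_combination hAB - h
  · left
    refine hc ((Dvd.intro_left A rfl).trans (dvd_of_eq (mul_right_cancel₀ hdm ?_)))
    linear_combination h + hfm
  · left
    refine hc ((Dvd.intro_left (-A) rfl).trans (dvd_of_eq (mul_right_cancel₀ hdm ?_)))
    linear_combination hfm - h

end Factor

lemma rootMultiplicity_quadZ_le_one {n m : ℕ} (hn : 1 < n) (hm : n + 1 < m) {z : ℂ}
    (hz : ∃ k, 0 < k ∧ z ^ k = 1) :
    ((quadZ n m).map (algebraMap ℤ ℂ)).rootMultiplicity z ≤ 1 := by
  have hf := ((quadZ_monic hn (show n < m by omega)).map (algebraMap ℤ ℂ)).ne_zero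
  by_contra! h
  rw [one_lt_rootMultiplicity_iff_isRoot hf] at h
  have h2 : 1 + n * z ^ (n - 1) + m * z ^ (m - 1) = 0 := by
    simpa [quadZ, derivative_X_pow] using h.2
  obtain ⟨k, hk, hzk⟩ := hz
  have hnorm : ‖z‖ = 1 := Complex.norm_eq_one_of_pow_eq_one hzk hk.ne'
  have h3 : (m : ℂ) * z ^ (m - 1) = -(1 + n * z ^ (n - 1)) := by linear_combination h2
  have h4 := congrArg norm h3
  rw [norm_neg] at h4
  have h5 := norm_add_le (1 : ℂ) (n * z ^ (n - 1))
  rw [← h4] at h5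
  simp [hnorm] at h5
  have : (m : ℝ) ≤ (1 + n : ℕ) := by exact_mod_cast h5
  have := Nat.cast_le.1 this
  omega

lemma natDegree_eq_card_of_dvd_quadZ {n m : ℕ} (hn : 1 < n) (hm : n + 1 < m) {A : ℤ[X]}
    (hA : A ∣ quadZ n m) (hAm : A.Monic) (hr : ∀ z : ℂ, aeval z A = 0 → ∃ k, 0 < k ∧ z ^ k = 1)
    (T : Finset ℂ) (hT : ∀ z, z ∈ T ↔ aeval z A = 0) : A.natDegree = T.card := by
  have hA0 := (hAm.map (algebraMap ℤ ℂ)).ne_zero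
  have hf := ((quadZ_monic hn (show n < m by omega)).map (algebraMap ℤ ℂ)).ne_zero
  have hmem : ∀ z, z ∈ (A.map (algebraMap ℤ ℂ)).roots ↔ aeval z A = 0 := fun z => by
    rw [mem_roots hA0, IsRoot, eval_map_algebraMap]
  have hnodup : (A.map (algebraMap ℤ ℂ)).roots.Nodup := by
    rw [Multiset.nodup_iff_count_le_one]
    intro z
    by_cases hz : z ∈ (A.map (algebraMap ℤ ℂ)).roots
    · rw [count_roots]
      exact (rootMultiplicity_le_rootMultiplicity_of_dvd hf (Polynomial.map_dvd _ hA) z).trans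
        (rootMultiplicity_quadZ_le_one hn hm (hr z ((hmem z).1 hz)))
    · rw [Multiset.count_eq_zero_of_notMem hz]
      exact zero_le_one
  have hTr : T = (A.map (algebraMap ℤ ℂ)).roots.toFinset := by
    ext z
    rw [hT, Multiset.mem_toFinset, hmem]
  rw [hTr, Multiset.toFinset_card_of_nodup hnodup, ← (IsAlgClosed.splits _).natDegree_eq_card_roots,
    hAm.natDegree_map]

/-- **Ljunggren.** If the quadrinomial `f = -1 + x + x^n + x^{m₁} ∈ B` has no root
which is a root of unity, then it is irreducible over `ℚ`; if it has exactly `q`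
roots of unity among its roots, then it is the product of two nonconstant factors,
one a product of cyclotomic polynomials of degree `q` vanishing exactly at these
roots of unity, the other irreducible and nonreciprocal. -/
theorem ljunggren_quadrinomial (n m : ℕ) (hn : 3 ≤ n) (hm : n + (n - 1) ≤ m) :
    ((∀ z : ℂ, aeval z (quad n m) = 0 → ¬ ∃ k : ℕ, 0 < k ∧ z ^ k = 1) →
      Irreducible (quad n m)) ∧
    (∀ q : ℕ, 0 < q → ∀ T : Finset ℂ,
      (∀ z : ℂ, z ∈ T ↔ (aeval z (quad n m) = 0 ∧ ∃ k : ℕ, 0 < k ∧ z ^ k = 1)) →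
      T.card = q →
      ∃ A B : Polynomial ℚ,
        quad n m = A * B ∧
        A.natDegree = q ∧
        (∃ l : Multiset ℕ, (∀ k ∈ l, 0 < k) ∧
          A = (l.map (fun k => cyclotomic k ℚ)).prod) ∧
        (∀ z : ℂ, aeval z A = 0 ↔ (aeval z (quad n m) = 0 ∧ ∃ k : ℕ, 0 < k ∧ z ^ k = 1)) ∧
        Irreducible B ∧ B.reverse ≠ B) := by
  have hn' : 1 < n := by omega
  have hm' : n < m := by omega
  have hmonic := quadZ_monic hn' hm'
  have haeval : ∀ (z : ℂ) (p : ℤ[X]), aeval z (p.map (Int.castRingHom ℚ)) = aeval z p :=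
    fun z p => aeval_map_algebraMap ℚ z p
  have hirr : ∀ {p : ℤ[X]}, p.Monic → Irreducible p → Irreducible (p.map (Int.castRingHom ℚ)) :=
    fun hp => (hp.irreducible_iff_irreducible_map_fraction_map (K := ℚ)).1
  obtain ⟨w, hw, hwk⟩ := exists_root_quadZ_not_root_of_unity hn' hm'
  rw [← map_quadZ]
  simp only [haeval]
  constructor
  · intro h
    refine hirr hmonic (irreducible_cofactor hn hm (one_mul _).symm h fun hu => ?_)
    rw [hmonic.isUnit_iff.1 hu] at hw
    simp at hw
  · rintro q - T hT rfl
    obtain ⟨l, B, hl, hAB, hB⟩ := exists_cyclotomic_mul _ hmonic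
    have hAr := fun z => exists_pow_eq_one_of_aeval_cyclotomic_prod (z := z) hl
    have hAm : (l.map (fun k => cyclotomic k ℤ)).prod.Monic :=
      monic_multiset_prod_of_monic _ _ fun k _ => cyclotomic.monic k ℤ
    have hAq : (l.map (fun k => cyclotomic k ℤ)).prod.map (Int.castRingHom ℚ) =
        (l.map (fun k => cyclotomic k ℚ)).prod := by
      rw [Polynomial.map_multiset_prod, Multiset.map_map]
      simp
    generalize (l.map (fun k => cyclotomic k ℤ)).prod = A at *
    have hBm : B.Monic := hAm.of_mul_monic_left (hAB ▸ hmonic)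
    have hB1 : ¬ IsUnit B := fun hu => by
      rw [hBm.isUnit_iff.1 hu, mul_one] at hAB
      exact hwk (hAr w (hAB ▸ hw))
    have hroots : ∀ z : ℂ, aeval z A = 0 ↔
        (aeval z (quadZ n m) = 0 ∧ ∃ k : ℕ, 0 < k ∧ z ^ k = 1) := fun z => by
      refine ⟨fun h => ⟨by rw [hAB, map_mul, h, zero_mul], hAr z h⟩, fun ⟨h, hk⟩ => ?_⟩
      rw [hAB, map_mul, mul_eq_zero] at h
      exact h.resolve_right fun h => hB z h hk
    refine ⟨A.map (Int.castRingHom ℚ), B.map (Int.castRingHom ℚ), ?_, ?_, ⟨l, hl, hAq⟩, ?_,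
      hirr hBm (irreducible_cofactor hn hm hAB hB hB1), fun hrev => ?_⟩
    · rw [hAB, Polynomial.map_mul]
    · rw [hAm.natDegree_map]
      exact natDegree_eq_card_of_dvd_quadZ hn' (by omega) ⟨B, hAB⟩ hAm hAr T
        fun z => (hT z).trans (hroots z).symm
    · simpa only [haeval] using hroots
    · have hB0 : B.coeff 0 ≠ 0 := fun h => by
        have := quadZ_coeff_zero hn' hm'
        rw [hAB, mul_coeff_zero, h] at this
        simp at this
      have hmir : B.mirror = B := by
        rw [mirror, natTrailingDegree_eq_zero.2 (.inr hB0), pow_zero, mul_one]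
        refine map_injective _ (Int.castRingHom ℚ).injective_int ?_
        rwa [reverse, hBm.natDegree_map, reflect_map] at hrev
      refine hB1 (isUnit_of_dvd_of_dvd_mirror hn' hm' hAB hB dvd_rfl ?_)
      rw [hAB, mirror_mul_of_domain, hmir]
      exact Dvd.intro_left _ rfl
end

section
/- Let f(x) = -1 + x + x^n + x^{m_1} be a quadrinomial in the class B (so n ≥ 3 and m_1 - n ≥ n - 1). Set e_1 = gcd(m_1, n - 1) and e_2 = gcd(n, m_1 - 1). Then every root of f which is a root of unity is a simple root of f, and every such root z satisfies z^{e_1} = 1, or z^{e_1} = -1, or z^{e_2} = 1, or z^{e_2} = -1, or z = -1. -/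
open Polynomial

open ComplexConjugate in
/-- If three complex numbers of modulus one add up to `1`, then one of them is `1`. -/
theorem eq_one_of_norm_one_of_add_eq_one {a b c : ℂ} (ha : ‖a‖ = 1) (hb : ‖b‖ = 1)
    (hc : ‖c‖ = 1) (h : a + b + c = 1) : a = 1 ∨ b = 1 ∨ c = 1 := by
  have key : ∀ u : ℂ, ‖u‖ = 1 → u * conj u = 1 := fun u hu => by
    rw [Complex.mul_conj, Complex.normSq_eq_norm_sq, hu]
    norm_num
  have ha' := key a ha
  have hb' := key b hb
  have hc' := key c hc
  have h' : conj a + conj b + conj c = 1 := by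
    simpa using congrArg conj h
  have hprod : (1 - a) * ((1 - b) * (1 - c)) = 0 := by
    linear_combination (-1 : ℂ) * h + a * b * c * h' - b * c * ha' - a * c * hb' - a * b * hc'
  rcases mul_eq_zero.mp hprod with h1 | h1
  · exact Or.inl (sub_eq_zero.mp h1).symm
  · rcases mul_eq_zero.mp h1 with h2 | h2
    · exact Or.inr (Or.inl (sub_eq_zero.mp h2).symm)
    · exact Or.inr (Or.inr (sub_eq_zero.mp h2).symm)

/-- If `z ^ a = 1` and `z ^ b = -1`, then `z ^ gcd a b = ± 1`. -/
theorem pow_gcd_eq_one_or_neg_one {R : Type*} [CommRing R] [IsDomain R] {z : R} {a b : ℕ}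
    (ha : z ^ a = 1) (hb : z ^ b = -1) : z ^ Nat.gcd a b = 1 ∨ z ^ Nat.gcd a b = -1 := by
  have ha2 : orderOf z ∣ 2 * a := (orderOf_dvd_of_pow_eq_one ha).mul_left 2
  have hb2 : orderOf z ∣ 2 * b := orderOf_dvd_of_pow_eq_one (by rw [mul_comm, pow_mul, hb]; ring)
  have hd : orderOf z ∣ Nat.gcd a b * 2 := by
    rw [mul_comm, ← Nat.gcd_mul_left]
    exact Nat.dvd_gcd ha2 hb2
  rw [← sq_eq_one_iff, ← pow_mul]
  exact orderOf_dvd_iff_pow_eq_one.mp hd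

/-- If `k * z = l` with `k`, `l` natural and `z` of modulus one, then `k = l`. -/
theorem natCast_eq_of_mul_eq_of_norm_one {z : ℂ} (hz : ‖z‖ = 1) {k l : ℕ}
    (h : (k : ℂ) * z = l) : k = l := by
  have := congrArg norm h
  rw [norm_mul, hz, mul_one, Complex.norm_natCast, Complex.norm_natCast] at this
  exact_mod_cast this

/-- **Ljunggren.** Every root of unity which is a root of the quadrinomial
`f = -1 + x + x^n + x^{m₁} ∈ B` is a simple root, and satisfies `z^{e₁} = ±1`,
`z^{e₂} = ±1` or `z = -1`, where `e₁ = gcd(m₁, n-1)` and `e₂ = gcd(n, m₁-1)`. -/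
theorem ljunggren_roots_of_unity (n m : ℕ) (hn : 3 ≤ n) (hm : n + (n - 1) ≤ m) :
    ∀ z : ℂ, aeval z (quad n m) = 0 → (∃ k : ℕ, 0 < k ∧ z ^ k = 1) →
      aeval z (derivative (quad n m)) ≠ 0 ∧
      (z ^ Nat.gcd m (n - 1) = 1 ∨ z ^ Nat.gcd m (n - 1) = -1 ∨
       z ^ Nat.gcd n (m - 1) = 1 ∨ z ^ Nat.gcd n (m - 1) = -1 ∨ z = -1) := by
  rintro z hroot ⟨k, hk, hzk⟩
  have hz : ‖z‖ = 1 := Complex.norm_eq_one_of_pow_eq_one hzk hk.ne'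
  have hz0 : z ≠ 0 := by
    rintro rfl
    simp at hz
  have hpow : ∀ j : ℕ, ‖z ^ j‖ = 1 := fun j => by rw [norm_pow, hz, one_pow]
  have hsum : z + z ^ n + z ^ m = 1 := by
    simp only [quad, map_add, map_neg, map_one, map_pow, aeval_X] at hroot
    linear_combination hroot
  have hderiv : aeval z (derivative (quad n m)) = 1 + n * z ^ (n - 1) + m * z ^ (m - 1) := by
    simp [quad, derivative_X_pow]
  have hzn : z ^ (n - 1) * z = z ^ n := pow_sub_one_mul (by omega) z
  have hzm : z ^ (m - 1) * z = z ^ m := pow_sub_one_mul (by omega) z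
  rw [hderiv]
  rcases eq_one_of_norm_one_of_add_eq_one hz (hpow n) (hpow m) hsum with h | h | h
  · subst h
    norm_num at hsum
  · have hm1 : z ^ (m - 1) = -1 := mul_right_cancel₀ hz0 (by linear_combination hzm + hsum - h)
    refine ⟨fun h0 => ?_, ?_⟩
    · have hmn : ((m - 1 : ℕ) : ℂ) * z = n := by
        rw [Nat.cast_sub (by omega), Nat.cast_one]
        linear_combination (-z) * h0 + n * hzn + n * h + m * z * hm1
      have := natCast_eq_of_mul_eq_of_norm_one hz hmn
      omega
    · rcases pow_gcd_eq_one_or_neg_one h hm1 with h1 | h1 <;> simp [h1]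
  · have hn1 : z ^ (n - 1) = -1 := mul_right_cancel₀ hz0 (by linear_combination hzn + hsum - h)
    refine ⟨fun h0 => ?_, ?_⟩
    · have hmn : ((n - 1 : ℕ) : ℂ) * z = m := by
        rw [Nat.cast_sub (by omega), Nat.cast_one]
        linear_combination (-z) * h0 + m * hzm + m * h + n * z * hn1
      have := natCast_eq_of_mul_eq_of_norm_one hz hmn
      omega
    · rcases pow_gcd_eq_one_or_neg_one h hn1 with h1 | h1 <;> simp [h1]
end

section
/- Let f(x) = -1 + x + x^n + x^{m_1} be a quadrinomial in the class B (so n ≥ 3 and m_1 - n ≥ n - 1). If both n and m_1 are odd integers, then f is irreducible over ℚ. -/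
open Polynomial

/-- The polynomial `x^m + x^a + x^b - 1` over `ℤ`. -/
noncomputable def intQuad (m a b : ℕ) : ℤ[X] := X ^ m + X ^ a + X ^ b - 1

theorem natDegree_intQuad {m a b : ℕ} (ha : a < m) (hb : b < m) :
    (intQuad m a b).natDegree = m := by
  have : 0 < m := by omega
  unfold intQuad
  compute_degree!
  · simp [ha.ne', hb.ne', this.ne']
  all_goals omega

theorem monic_intQuad {m a b : ℕ} (ha : a < m) (hb : b < m) : (intQuad m a b).Monic := by
  rw [Monic, leadingCoeff, natDegree_intQuad ha hb]
  have : m ≠ 0 := by omega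
  simp [intQuad, coeff_X_pow, coeff_one, ha.ne', hb.ne', this]

theorem coeff_zero_intQuad {m a b : ℕ} (hm : m ≠ 0) (ha : a ≠ 0) (hb : b ≠ 0) :
    (intQuad m a b).coeff 0 = -1 := by
  simp [intQuad, coeff_X_pow, hm.symm, ha.symm, hb.symm]

theorem mirror_eq_reflect {R : Type*} [Semiring R] {p : R[X]} (h : p.coeff 0 ≠ 0) :
    p.mirror = reflect p.natDegree p := by
  rw [mirror, natTrailingDegree_eq_zero.2 (Or.inr h), pow_zero, mul_one, reverse]

theorem mirror_intQuad {m a b : ℕ} (ha : a < m) (hb : b < m) (ha0 : a ≠ 0) (hb0 : b ≠ 0) :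
    (intQuad m a b).mirror = 1 + X ^ (m - a) + X ^ (m - b) - X ^ m := by
  have h0 := coeff_zero_intQuad (m := m) (by omega) ha0 hb0
  rw [mirror_eq_reflect (by rw [h0]; norm_num), natDegree_intQuad ha hb, intQuad, reflect_sub,
    reflect_add, reflect_add, ← pow_zero (X : ℤ[X])]
  simp only [reflect_monomial, revAt_le ha.le, revAt_le hb.le, revAt_le le_rfl,
    revAt_le (Nat.zero_le m)]
  simp

theorem coeff_intQuad_mul_mirror {m a b j : ℕ} (hab : b < a) (ha : a < m) (hb : 0 < b)
    (hj : 0 < j) (hjm : j < m) :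
    (intQuad m a b * (intQuad m a b).mirror).coeff (m + j) =
      (if j = m - a then 1 else 0) + (if j = m - b then 1 else 0) + (if j = a - b then 1 else 0)
        - (if j = a then 1 else 0) - (if j = b then 1 else 0) := by
  rw [mirror_intQuad ha (by omega) (by omega) (by omega), intQuad]
  simp only [add_mul, sub_mul, mul_add, mul_sub, ← pow_add, mul_one, one_mul, coeff_add,
    coeff_sub, coeff_X_pow, coeff_one]
  grind (splits := 20)

theorem intQuad_eq_of_mul_mirror_eq {m n a b : ℕ} (hn : 1 < n) (hnm : n < m)
    (hnodd : Odd n) (hmodd : Odd m) (hab : b < a) (ha : a < m) (hb : 0 < b)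
    (h : intQuad m n 1 * (intQuad m n 1).mirror = intQuad m a b * (intQuad m a b).mirror) :
    a = n ∧ b = 1 := by
  have key (j : ℕ) (hj : 0 < j) (hjm : j < m) := congrArg (coeff · (m + j)) h
  have h1 := key 1 (by omega) (by omega)
  have h2 := key n (by omega) (by omega)
  beta_reduce at h1 h2
  rw [coeff_intQuad_mul_mirror hn hnm (by omega) (by omega) (by omega),
    coeff_intQuad_mul_mirror hab ha hb (by omega) (by omega)] at h1 h2
  obtain ⟨u, rfl⟩ := hnodd
  obtain ⟨v, rfl⟩ := hmodd
  clear key h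
  have e1 : 1 = a ∨ 1 = b := by
    clear h2
    grind (splits := 20)
  have e2 : 2 * u + 1 = a ∨ 2 * u + 1 = b := by
    clear h1
    grind (splits := 20)
  omega

theorem isRelPrime_intQuad_mirror {m n : ℕ} (hn : 1 < n) (hnm : n < m)
    (hnodd : Odd n) (hmodd : Odd m) :
    IsRelPrime (intQuad m n 1) (intQuad m n 1).mirror := by
  intro d hd hd'
  have hu : IsUnit d.leadingCoeff := by
    obtain ⟨e, he⟩ := hd
    have := monic_intQuad hnm (by omega : 1 < m)
    rw [Monic, he, leadingCoeff_mul] at this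
    exact .of_mul_eq_one _ this
  by_cases hdeg : d.degree = 0
  · rw [eq_C_of_degree_eq_zero hdeg] at hu ⊢
    rw [leadingCoeff_C] at hu
    exact hu.map C
  obtain ⟨z, hz⟩ := IsAlgClosed.exists_root (d.map (Int.castRingHom ℂ)) (by
    rwa [degree_map_eq_of_injective (RingHom.injective_int _)])
  have hz0 : aeval z d = 0 := by
    rwa [IsRoot, eval_map] at hz
  have h1 : aeval z (intQuad m n 1) = 0 := by
    obtain ⟨e, he⟩ := hd
    rw [he, map_mul, hz0, zero_mul]
  have h2 : aeval z (intQuad m n 1).mirror = 0 := by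
    obtain ⟨e, he⟩ := hd'
    rw [he, map_mul, hz0, zero_mul]
  rw [mirror_intQuad hnm (by omega) (by omega) (by omega)] at h2
  simp only [intQuad, map_add, map_sub, map_pow, aeval_X, map_one, pow_one] at h1 h2
  have hb : z ^ (m - n) * z ^ n = z ^ m := by rw [← pow_add]; congr 1; omega
  have ha : z ^ (m - 1) * z = z ^ m := by rw [← pow_succ]; congr 1; omega
  have hprod : (1 - z) * (1 - z ^ n) * (1 - z ^ m) = 0 := by
    linear_combination -h1 + z * z ^ n * h2 - z * hb - z ^ n * ha
  have hne : z ≠ 0 := by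
    rintro rfl
    simp [show m ≠ 0 by omega, show n ≠ 0 by omega] at h1
  have hneg (k l : ℕ) (hk : z ^ k = 1) (hkodd : Odd k) (hl : Odd l) (h : z ^ l + z = 0) :
      False := by
    obtain ⟨t, rfl⟩ := hl
    have h3 : z ^ (2 * t) = -1 := by
      have : z * (z ^ (2 * t) + 1) = 0 := by linear_combination h
      rcases mul_eq_zero.1 this with h | h
      · exact absurd h hne
      · linear_combination h
    have h4 : (z ^ (2 * t)) ^ k = 1 := by rw [← pow_mul, mul_comm, pow_mul, hk, one_pow]
    rw [h3, hkodd.neg_one_pow] at h4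
    norm_num at h4
  rcases mul_eq_zero.1 hprod with h | h
  · rcases mul_eq_zero.1 h with h | h
    · obtain rfl : z = 1 := by linear_combination -h
      norm_num at h1
    · exact (hneg n m (by linear_combination -h) hnodd hmodd (by linear_combination h1 + h)).elim
  · exact (hneg m n (by linear_combination -h) hmodd hnodd (by linear_combination h1 + h)).elim

theorem sum_range_succ_eq_add_sum_Ioo {m : ℕ} (hm : 0 < m) (g : ℕ → ℤ) :
    ∑ i ∈ Finset.range (m + 1), g i = g 0 + g m + ∑ i ∈ Finset.Ioo 0 m, g i := by
  have : Finset.range (m + 1) = insert 0 (insert m (Finset.Ioo 0 m)) := by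
    ext i; simp; omega
  rw [this, Finset.sum_insert (by simp; omega), Finset.sum_insert (by simp), add_assoc]

theorem exists_eq_of_sum_sq_eq_two {ι : Type*} {S : Finset ι} {c : ι → ℤ} {s : ℤ}
    (hs : s = 1 ∨ s = -1) (hsq : ∑ i ∈ S, c i ^ 2 = 2) (hsum : ∑ i ∈ S, c i = 2 * s) :
    ∃ p ∈ S, ∃ q ∈ S, p ≠ q ∧ c p = s ∧ c q = s ∧ ∀ i ∈ S, i ≠ p → i ≠ q → c i = 0 := by
  classical
  have hss : s * s = 1 := by rcases hs with rfl | rfl <;> norm_num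
  have hzero : ∑ i ∈ S, (c i ^ 2 - s * c i) = 0 := by
    rw [Finset.sum_sub_distrib, ← Finset.mul_sum, hsq, hsum]
    linear_combination -2 * hss
  have hc : ∀ i ∈ S, c i = 0 ∨ c i = s := by
    intro i hi
    have := (Finset.sum_eq_zero_iff_of_nonneg (fun j _ ↦ by
      rcases hs with rfl | rfl
      · nlinarith [Int.le_self_sq (c j)]
      · nlinarith [Int.le_self_sq (-c j)])).1 hzero i hi
    have : c i * (c i - s) = 0 := by linear_combination this
    rcases mul_eq_zero.1 this with h | h
    · exact .inl h
    · exact .inr (by linear_combination h)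
  have hcard : (S.filter (c · = s)).card = 2 := by
    zify
    rw [← hsq, Finset.card_filter]
    push_cast
    refine Finset.sum_congr rfl fun i hi ↦ ?_
    split_ifs with h
    · rw [h, sq, hss]
    · rw [(hc i hi).resolve_right h]; rfl
  obtain ⟨p, q, hpq, hT⟩ := Finset.card_eq_two.1 hcard
  have hmem (i) : i ∈ S ∧ c i = s ↔ i = p ∨ i = q := by
    simpa using Finset.ext_iff.1 hT i
  obtain ⟨hp, hp'⟩ := (hmem p).2 (.inl rfl)
  obtain ⟨hq, hq'⟩ := (hmem q).2 (.inr rfl)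
  refine ⟨p, hp, q, hq, hpq, hp', hq', fun i hi hip hiq ↦ (hc i hi).resolve_right fun h ↦ ?_⟩
  exact ((hmem i).1 ⟨hi, h⟩).elim hip hiq

theorem exists_eq_intQuad {m : ℕ} {k : ℤ[X]} (hm : 0 < m) (hdeg : k.natDegree = m)
    (hends : k.coeff 0 * k.coeff m = -1)
    (hsq : ∑ i ∈ Finset.range (m + 1), k.coeff i ^ 2 = 4) (heval : k.eval 1 ^ 2 = 4) :
    ∃ a b, 0 < b ∧ b < a ∧ a < m ∧ (k = intQuad m a b ∨ k = -intQuad m a b ∨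
      k = (intQuad m a b).mirror ∨ k = -(intQuad m a b).mirror) := by
  rw [eval_eq_sum_range, hdeg] at heval
  simp only [one_pow, mul_one] at heval
  rw [sum_range_succ_eq_add_sum_Ioo hm] at hsq heval
  obtain ⟨s, hs, hsum⟩ : ∃ s : ℤ, (s = 1 ∨ s = -1) ∧
      k.coeff 0 + k.coeff m + ∑ i ∈ Finset.Ioo 0 m, k.coeff i = 2 * s := by
    rcases sq_eq_sq_iff_eq_or_eq_neg.1 (heval.trans (by norm_num : (4 : ℤ) = 2 ^ 2)) with h | h
    · exact ⟨1, .inl rfl, h⟩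
    · exact ⟨-1, .inr rfl, h⟩
  obtain ⟨t, ht, h0, hmm⟩ : ∃ t : ℤ, (t = 1 ∨ t = -1) ∧ k.coeff 0 = -t ∧ k.coeff m = t := by
    rcases Int.mul_eq_neg_one_iff_eq_one_or_neg_one.1 hends with ⟨h, h'⟩ | ⟨h, h'⟩
    · exact ⟨-1, .inr rfl, h, h'⟩
    · exact ⟨1, .inl rfl, h, h'⟩
  rw [h0, hmm] at hsq hsum
  have htt : t * t = 1 := by rcases ht with rfl | rfl <;> norm_num
  obtain ⟨p, q, hq, hqp, hp, hcp, hcq, hc⟩ : ∃ p q, 0 < q ∧ q < p ∧ p < m ∧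
      k.coeff p = s ∧ k.coeff q = s ∧ ∀ i ∈ Finset.Ioo 0 m, i ≠ p → i ≠ q → k.coeff i = 0 := by
    obtain ⟨p, hp, q, hq, hpq, hcp, hcq, hc⟩ := exists_eq_of_sum_sq_eq_two hs
      (by linear_combination hsq - 2 * htt) (by linear_combination hsum)
    rw [Finset.mem_Ioo] at hp hq
    rcases hpq.lt_or_gt with h | h
    · exact ⟨q, p, hp.1, h, hq.2, hcq, hcp, fun i hi h1 h2 ↦ hc i hi h2 h1⟩
    · exact ⟨p, q, hq.1, h, hp.2, hcp, hcq, hc⟩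
  have hk : k = C t * (X ^ m - 1) + C s * (X ^ p + X ^ q) := by
    ext i
    simp only [coeff_add, coeff_sub, coeff_C_mul, coeff_X_pow, coeff_one]
    rcases lt_or_ge m i with hi | hi
    · rw [coeff_eq_zero_of_natDegree_lt (hdeg ▸ hi)]
      grind
    · grind
  rcases eq_or_ne s t with rfl | hst
  · refine ⟨p, q, hq, hqp, hp, ?_⟩
    rcases hs with rfl | rfl
    · left; rw [hk, intQuad]; simp; ring
    · right; left; rw [hk, intQuad]; simp; ring
  · refine ⟨m - q, m - p, by omega, by omega, by omega, .inr (.inr ?_)⟩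
    rw [mirror_intQuad (by omega) (by omega) (by omega) (by omega), Nat.sub_sub_self (by omega),
      Nat.sub_sub_self (by omega), hk]
    rcases hs with rfl | rfl <;> rcases ht with rfl | rfl <;> first | exact absurd rfl hst | skip
    · left; simp; ring
    · right; simp; ring

theorem sum_sq_coeff_intQuad {m a b : ℕ} (hab : b < a) (ha : a < m) (hb : 0 < b) :
    ∑ i ∈ Finset.range (m + 1), (intQuad m a b).coeff i ^ 2 = 4 := by
  have (i : ℕ) : (intQuad m a b).coeff i ^ 2 = (if i = m then 1 else 0) +
      (if i = a then 1 else 0) + (if i = b then 1 else 0) + (if i = 0 then 1 else 0) := by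
    simp only [intQuad, coeff_add, coeff_sub, coeff_X_pow, coeff_one]
    grind
  simp only [this, Finset.sum_add_distrib, Finset.sum_ite_eq', Finset.mem_range]
  simp [show a < m + 1 by omega, show b < m + 1 by omega]

theorem sum_sq_coeff_eq_coeff_mul_mirror {k : ℤ[X]} (h : k.coeff 0 ≠ 0) :
    ∑ i ∈ Finset.range (k.natDegree + 1), k.coeff i ^ 2 =
      (k * k.mirror).coeff k.natDegree := by
  have := k.coeff_mul_mirror
  rw [natTrailingDegree_eq_zero.2 (.inr h), add_zero] at this
  rw [this, sum_over_range _ (by simp)]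

theorem irreducible_intQuad {m n : ℕ} (hn : 1 < n) (hnm : n < m)
    (hnodd : Odd n) (hmodd : Odd m) : Irreducible (intQuad m n 1) := by
  have hfdeg : (intQuad m n 1).natDegree = m := natDegree_intQuad hnm (by omega)
  have hf0 : (intQuad m n 1).coeff 0 = -1 := coeff_zero_intQuad (by omega) (by omega) (by omega)
  have hfmonic : (intQuad m n 1).Monic := monic_intQuad hnm (by omega)
  have hend {k : ℤ[X]} (h : k.coeff 0 ≠ 0) :
      (k * k.mirror).leadingCoeff = k.coeff 0 * k.coeff k.natDegree := by
    rw [leadingCoeff_mul, mirror_leadingCoeff, trailingCoeff,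
      natTrailingDegree_eq_zero.2 (.inr h), leadingCoeff, mul_comm]
  have hfsq := sum_sq_coeff_eq_coeff_mul_mirror (k := intQuad m n 1) (by rw [hf0]; norm_num)
  rw [hfdeg, sum_sq_coeff_intQuad hn hnm one_pos] at hfsq
  refine irreducible_of_mirror ?_ (fun k hk ↦ ?_) (isRelPrime_intQuad_mirror hn hnm hnodd hmodd)
  · intro h
    have := natDegree_eq_zero_of_isUnit h
    omega
  have hdeg : k.natDegree = m := by
    have := congrArg natDegree hk
    rw [natDegree_mul_mirror, natDegree_mul_mirror, hfdeg] at this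
    omega
  have hkne : k ≠ 0 := by
    rintro rfl
    rw [natDegree_zero] at hdeg
    omega
  have hk0 : k.coeff 0 ≠ 0 := by
    have := congrArg natTrailingDegree hk
    rw [natTrailingDegree_mul_mirror, natTrailingDegree_mul_mirror,
      natTrailingDegree_eq_zero.2 (.inr (by rw [hf0]; norm_num))] at this
    exact (natTrailingDegree_eq_zero.1 (by omega)).resolve_left hkne
  obtain ⟨a, b, hb, hab, ha, hcases⟩ := exists_eq_intQuad (m := m) (k := k) (by omega) hdeg
    (by rw [← hdeg, ← hend hk0, ← hk, hend (by rw [hf0]; norm_num), hf0, coeff_natDegree,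
          hfmonic.leadingCoeff, mul_one])
    (by rw [← hdeg, sum_sq_coeff_eq_coeff_mul_mirror hk0, ← hk, hdeg, ← hfsq])
    (by
      have := congrArg (eval 1) hk
      rw [eval_mul, eval_mul, mirror_eval_one, mirror_eval_one] at this
      rw [sq, ← this]
      simp [intQuad])
  have hQ : intQuad m n 1 * (intQuad m n 1).mirror = intQuad m a b * (intQuad m a b).mirror := by
    rw [hk]
    rcases hcases with rfl | rfl | rfl | rfl <;> simp only [mirror_neg, mirror_mirror] <;> ring
  obtain ⟨rfl, rfl⟩ := intQuad_eq_of_mul_mirror_eq hn hnm hnodd hmodd hab ha hb hQ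
  exact hcases

/-- **Ljunggren.** If both `n` and `m₁` are odd, then the quadrinomial
`f = -1 + x + x^n + x^{m₁} ∈ B` is irreducible over `ℚ`. -/
theorem ljunggren_odd_irreducible (n m : ℕ) (hn : 3 ≤ n) (hm : n + (n - 1) ≤ m)
    (hnodd : Odd n) (hmodd : Odd m) :
    Irreducible (quad n m) := by
  have hmap : quad n m = (intQuad m n 1).map (algebraMap ℤ ℚ) := by
    simp [quad, intQuad]
    ring
  rw [hmap, ← (monic_intQuad (by omega) (by omega)).irreducible_iff_irreducible_map_fraction_map]
  exact irreducible_intQuad (by omega) (by omega) hnodd hmodd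
end

section
/- Let f(x) = -1 + x + x^n + x^{m_1} be a quadrinomial in the class B (so n ≥ 3 and m_1 - n ≥ n - 1), and write f = A·B where every root of A is a root of unity and no root of B is a root of unity. Then A(x) is (up to sign) the greatest common divisor of f(x) and its reciprocal polynomial f*(x) = x^{m_1}·f(1/x), A is reciprocal and a product of cyclotomic polynomials, and B is irreducible and nonreciprocal, except when f(x) = -1 + x + x^7 + x^8, in which case -1 + x + x^7 + x^8 = (x^2 + 1)(x^3 + x^2 - 1)(x^3 - x + 1), where the factors x^3 + x^2 - 1 and x^3 - x + 1 are irreducible and nonreciprocal. -/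
open Polynomial

/-- An integer polynomial with four terms, written in increasing order of the exponents
`0`, `a`, `b`, `m`. -/
noncomputable def fourTerm (a b m : ℕ) (u s t w : ℤ) : ℤ[X] :=
  monomial 0 u + monomial a s + monomial b t + monomial m w

section FourTerm

variable {a b m : ℕ} {u s t w : ℤ}

theorem coeff_fourTerm (i : ℕ) : (fourTerm a b m u s t w).coeff i =
    (if 0 = i then u else 0) + (if a = i then s else 0) + (if b = i then t else 0) +
      (if m = i then w else 0) := by
  simp only [fourTerm, coeff_add, coeff_monomial]

theorem natDegree_fourTerm (ha : 0 < a) (hab : a < b) (hbm : b < m) (hw : w ≠ 0) :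
    (fourTerm a b m u s t w).natDegree = m := by
  refine natDegree_eq_of_le_of_coeff_ne_zero ?_ ?_
  · rw [natDegree_le_iff_coeff_eq_zero]
    intro N hN
    simp [coeff_fourTerm, show a ≠ N by omega, show b ≠ N by omega,
      show m ≠ N by omega, show 0 ≠ N by omega]
  · simpa [coeff_fourTerm, show a ≠ m by omega, show b ≠ m by omega,
      show 0 ≠ m by omega] using hw

theorem coeff_zero_fourTerm (ha : 0 < a) (hab : a < b) (hbm : b < m) :
    (fourTerm a b m u s t w).coeff 0 = u := by
  simp [coeff_fourTerm, show a ≠ 0 by omega, show b ≠ 0 by omega, show m ≠ 0 by omega]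

theorem natTrailingDegree_fourTerm (ha : 0 < a) (hab : a < b) (hbm : b < m) (hu : u ≠ 0) :
    (fourTerm a b m u s t w).natTrailingDegree = 0 :=
  natTrailingDegree_eq_zero.mpr (Or.inr (by rwa [coeff_zero_fourTerm ha hab hbm]))

theorem mirror_fourTerm (ha : 0 < a) (hab : a < b) (hbm : b < m) (hu : u ≠ 0) (hw : w ≠ 0) :
    (fourTerm a b m u s t w).mirror = fourTerm (m - b) (m - a) m w t s u := by
  rw [mirror, natTrailingDegree_fourTerm ha hab hbm hu, pow_zero, mul_one, reverse,
    natDegree_fourTerm ha hab hbm hw]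
  simp only [fourTerm, reflect_add, ← C_mul_X_pow_eq_monomial, reflect_C_mul_X_pow]
  rw [revAt_le (by omega), revAt_le (by omega), revAt_le (by omega), revAt_le (by omega),
    Nat.sub_zero, Nat.sub_self]
  ring

theorem coeff_fourTerm_mul_mirror (ha : 0 < a) (hab : a < b) (hbm : b < m) (hu : u ≠ 0)
    (hw : w ≠ 0) {j : ℕ} (hj : 0 < j) :
    (fourTerm a b m u s t w * (fourTerm a b m u s t w).mirror).coeff (m + j) =
      (if j = a then u * s else 0) + (if j = b then u * t else 0) + (if j = m then u * w else 0) +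
      (if j = b - a then s * t else 0) + (if j = m - a then s * w else 0) +
      (if j = m - b then t * w else 0) := by
  rw [mirror_fourTerm ha hab hbm hu hw]
  simp only [fourTerm, mul_add, add_mul, monomial_mul_monomial, coeff_add, coeff_monomial]
  simp only [zero_add, add_zero]
  simp only [show (0 = m + j) = False by simp; omega,
    show (m - b = m + j) = False by simp; omega,
    show (m - a = m + j) = False by simp; omega,
    show (m = m + j) = False by simp; omega,
    show (a = m + j) = False by simp; omega,
    show (b = m + j) = False by simp; omega,
    show (a + (m - b) = m + j) = False by simp; omega,
    show (a + (m - a) = m + j) = False by simp; omega,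
    show (b + (m - b) = m + j) = False by simp; omega,
    show (a + m = m + j) = (j = a) by simp; omega,
    show (b + (m - a) = m + j) = (j = b - a) by simp; omega,
    show (b + m = m + j) = (j = b) by simp; omega,
    show (m + (m - b) = m + j) = (j = m - b) by simp; omega,
    show (m + (m - a) = m + j) = (j = m - a) by simp; omega,
    show (m + m = m + j) = (j = m) by simp; omega,
    if_false, zero_add, add_zero]
  simp only [mul_comm s u, mul_comm t u, mul_comm w u, mul_comm t s, mul_comm w s, mul_comm w t]
  ring

end FourTerm

/-- An integer polynomial with nonzero constant term and positive degree whose coefficients have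
square sum `4` has exactly four terms, with coefficients `±1`. -/
theorem exists_eq_fourTerm {k : ℤ[X]} (h0 : k.coeff 0 ≠ 0) (hd : 0 < k.natDegree)
    (hs : (k.sum fun _ c => c ^ 2) = 4) :
    ∃ a b : ℕ, 0 < a ∧ a < b ∧ b < k.natDegree ∧ ∃ u s t w : ℤ,
      u ^ 2 = 1 ∧ s ^ 2 = 1 ∧ t ^ 2 = 1 ∧ w ^ 2 = 1 ∧
        k = fourTerm a b k.natDegree u s t w := by
  have hk0 : k ≠ 0 := by rintro rfl; simp at h0
  have hsq : ∀ i ∈ k.support, k.coeff i ^ 2 = 1 := by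
    intro i hi
    obtain ⟨i', hi', hne⟩ : ∃ i' ∈ k.support, i' ≠ i := by
      by_cases h : i = 0
      · exact ⟨_, natDegree_mem_support_of_nonzero hk0, by omega⟩
      · exact ⟨0, mem_support_iff.mpr h0, Ne.symm h⟩
    have hle : ∑ l ∈ ({i, i'} : Finset ℕ), k.coeff l ^ 2 ≤ 4 := by
      rw [← hs, sum_def]
      refine Finset.sum_le_sum_of_subset_of_nonneg ?_ fun l _ _ => sq_nonneg _
      intro l hl
      rcases Finset.mem_insert.mp hl with rfl | hl
      · exact hi
      · rwa [Finset.mem_singleton.mp hl]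
    rw [Finset.sum_pair hne.symm] at hle
    have h1 : 0 < k.coeff i' ^ 2 := by have := mem_support_iff.mp hi'; positivity
    exact Int.sq_eq_one_of_sq_le_three (by omega) (mem_support_iff.mp hi)
  have hcard : k.support.card = 4 := by
    rw [sum_def, Finset.sum_congr rfl hsq, Finset.sum_const, Nat.smul_one_eq_cast] at hs
    exact_mod_cast hs
  obtain ⟨e, x, he, hx, hk⟩ := card_support_eq.mp hcard
  have e01 : e 0 < e 1 := he (by decide)
  have e12 : e 1 < e 2 := he (by decide)
  have e23 : e 2 < e 3 := he (by decide)
  have hcoeff (i : ℕ) : k.coeff i = (if e 0 = i then x 0 else 0) + (if e 1 = i then x 1 else 0) +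
      (if e 2 = i then x 2 else 0) + (if e 3 = i then x 3 else 0) := by
    rw [hk]
    simp only [Fin.sum_univ_four, C_mul_X_pow_eq_monomial, coeff_monomial, coeff_add]
  have hx2 (i : Fin 4) : x i ^ 2 = 1 := by
    have : k.coeff (e i) = x i := by
      fin_cases i <;> simp [hcoeff, he.injective.eq_iff]
    exact this ▸ hsq _ (mem_support_iff.mpr (this ▸ hx i))
  have e0 : e 0 = 0 := by
    by_contra h
    apply h0
    simp [hcoeff, h, show e 1 ≠ 0 by omega, show e 2 ≠ 0 by omega, show e 3 ≠ 0 by omega]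
  have e3 : k.natDegree = e 3 := by
    refine natDegree_eq_of_le_of_coeff_ne_zero ?_ ?_
    · rw [natDegree_le_iff_coeff_eq_zero]
      intro N hN
      simp [hcoeff, show e 0 ≠ N by omega, show e 1 ≠ N by omega, show e 2 ≠ N by omega,
        show e 3 ≠ N by omega]
    · simpa [hcoeff, he.injective.eq_iff] using hx 3
  refine ⟨e 1, e 2, by omega, e12, by omega, x 0, x 1, x 2, x 3, hx2 0, hx2 1, hx2 2, hx2 3, ?_⟩
  rw [e3, fourTerm, ← e0]
  conv_lhs => rw [hk]
  simp only [Fin.sum_univ_four, C_mul_X_pow_eq_monomial]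

/-- The exponents of `-1 + X ^ a + X ^ b + X ^ m` are determined by the signed multiset of their
differences. -/
theorem exponents_eq_of_differences {n m a b : ℕ} (hn : 3 ≤ n) (hm : n + (n - 1) ≤ m) (ha : 0 < a)
    (hab : a < b) (hbm : b < m)
    (H : ∀ j, 0 < j → j < m →
      (if j = 1 then -1 else 0) + (if j = n then -1 else 0) + (if j = n - 1 then 1 else 0) +
        (if j = m - 1 then 1 else 0) + (if j = m - n then 1 else 0) =
      (if j = a then -1 else 0) + (if j = b then -1 else 0) + (if j = b - a then 1 else 0) +
        (if j = m - a then 1 else 0) + (if j = m - b then (1 : ℤ) else 0)) :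
    a = 1 ∧ b = n := by
  have ha1 : a = 1 := by
    have h := H (m - 1) (by omega) (by omega)
    rw [if_neg (by omega), if_neg (by omega), if_neg (by omega), if_pos rfl,
      if_neg (by omega)] at h
    split_ifs at h <;> omega
  subst ha1
  refine ⟨rfl, ?_⟩
  by_contra hbn
  have h1 := H n (by omega) (by omega)
  have h2 := H b (by omega) hbm
  have hmn : m = 2 * n := by
    simp only [show n ≠ 1 by omega, show n ≠ n - 1 by omega, show n ≠ m - 1 by omega,
      Ne.symm hbn, if_true, if_false] at h1
    split_ifs at h1 <;> omega
  simp only [show b ≠ 1 by omega, show b ≠ b - 1 by omega, hbn, if_true, if_false] at h2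
  split_ifs at h2 <;> omega

theorem Int.eq_one_or_neg_one_of_sq_eq_one {c : ℤ} (hc : c ^ 2 = 1) : c = 1 ∨ c = -1 :=
  mul_self_eq_one_iff.mp (by rwa [← sq])

theorem middle_signs_eq {u s t w : ℤ} (hu : u ^ 2 = 1) (hs : s ^ 2 = 1) (ht : t ^ 2 = 1)
    (hw : w ^ 2 = 1) (huw : u * w = -1) (hsum : (u + s + t + w) ^ 2 = 4) :
    s = t ∧ (s = w ∨ s = u) := by
  rcases Int.eq_one_or_neg_one_of_sq_eq_one hu with rfl | rfl <;>
    rcases Int.eq_one_or_neg_one_of_sq_eq_one hs with rfl | rfl <;>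
    rcases Int.eq_one_or_neg_one_of_sq_eq_one ht with rfl | rfl <;>
    rcases Int.eq_one_or_neg_one_of_sq_eq_one hw with rfl | rfl <;> omega

theorem eq_of_fourTerm_mul_mirror_eq {n m : ℕ} (hn : 3 ≤ n) (hm : n + (n - 1) ≤ m) {k : ℤ[X]}
    (h : fourTerm 1 n m (-1) 1 1 1 * (fourTerm 1 n m (-1) 1 1 1).mirror = k * k.mirror) :
    k = fourTerm 1 n m (-1) 1 1 1 ∨ k = -fourTerm 1 n m (-1) 1 1 1 ∨
      k = (fourTerm 1 n m (-1) 1 1 1).mirror ∨ k = -(fourTerm 1 n m (-1) 1 1 1).mirror := by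
  have hn1 : 1 < n := by omega
  have hnm : n < m := by omega
  set f := fourTerm 1 n m (-1) 1 1 1 with hf
  have hfd : f.natDegree = m := natDegree_fourTerm one_pos hn1 hnm one_ne_zero
  have hft : f.natTrailingDegree = 0 :=
    natTrailingDegree_fourTerm one_pos hn1 hnm (by norm_num)
  have hkd : k.natDegree = m := by
    have := congrArg natDegree h
    rw [natDegree_mul_mirror, natDegree_mul_mirror] at this
    omega
  have hkt : k.natTrailingDegree = 0 := by
    have := congrArg natTrailingDegree h
    rw [natTrailingDegree_mul_mirror, natTrailingDegree_mul_mirror] at this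
    omega
  have hk0 : k.coeff 0 ≠ 0 := by
    refine (natTrailingDegree_eq_zero.mp hkt).resolve_left ?_
    rintro rfl
    simp at hkd
    omega
  have hfs : (f.sum fun _ c => c ^ 2) = 4 := by
    rw [f.sum_eq_of_subset (s := {0, 1, n, m}) (fun _ c => c ^ 2) (by simp)]
    · rw [Finset.sum_insert (by simp; omega), Finset.sum_insert (by simp; omega),
        Finset.sum_insert (by simp; omega), Finset.sum_singleton]
      simp [hf, coeff_fourTerm, hn1.ne, hn1.ne', hnm.ne, hnm.ne',
        show n ≠ 0 by omega, show 0 ≠ n by omega, show m ≠ 0 by omega, show 0 ≠ m by omega,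
        show m ≠ 1 by omega, show 1 ≠ m by omega]
    · intro i hi
      contrapose! hi
      simp only [Finset.mem_insert, Finset.mem_singleton, not_or] at hi
      simp [hf, coeff_fourTerm, Ne.symm hi.1, Ne.symm hi.2.1, Ne.symm hi.2.2.1,
        Ne.symm hi.2.2.2]
  have hks : (k.sum fun _ c => c ^ 2) = 4 := by
    have h1 := f.coeff_mul_mirror
    have h2 := k.coeff_mul_mirror
    rw [hfd, hft, hfs] at h1
    rw [hkd, hkt, ← h, h1] at h2
    exact h2.symm
  obtain ⟨a, b, ha, hab, hbm, u, s, t, w, hu, hs, ht, hw, hk⟩ :=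
    exists_eq_fourTerm hk0 (by omega) hks
  rw [hkd] at hbm hk
  have hne : ∀ {c : ℤ}, c ^ 2 = 1 → c ≠ 0 := by
    rintro _ hc rfl
    norm_num at hc
  have H (j : ℕ) (hj : 0 < j) := congrArg (coeff · (m + j)) h
  simp only [hk] at H
  have hone : (u + s + t + w) ^ 2 = 4 := by
    have := congrArg (eval 1) h
    rw [eval_mul, eval_mul, mirror_eval_one, mirror_eval_one, hk, hf] at this
    simp [fourTerm, eval_monomial] at this
    linarith
  have H' (j : ℕ) (hj : 0 < j) := by
    have := H j hj
    rwa [hf, coeff_fourTerm_mul_mirror one_pos hn1 hnm (by norm_num)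
      one_ne_zero hj, coeff_fourTerm_mul_mirror ha hab hbm (hne hu) (hne hw) hj] at this
  have huw : u * w = -1 := by
    have := H' m (by omega)
    simp only [show m ≠ 1 by omega, show m ≠ n by omega, show m ≠ n - 1 by omega,
      show m ≠ m - 1 by omega, show m ≠ m - n by omega, show m ≠ a by omega,
      show m ≠ b by omega, show m ≠ b - a by omega, show m ≠ m - a by omega,
      show m ≠ m - b by omega, if_true, if_false] at this
    linarith
  have H'' : ∀ j, 0 < j → j < m →
      (if j = 1 then -1 else 0) + (if j = n then -1 else 0) + (if j = n - 1 then 1 else 0) +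
        (if j = m - 1 then 1 else 0) + (if j = m - n then 1 else 0) =
      (if j = a then u * s else 0) + (if j = b then u * t else 0) +
        (if j = b - a then s * t else 0) + (if j = m - a then s * w else 0) +
        (if j = m - b then t * w else 0) := by
    intro j hj hjm
    simpa [hjm.ne] using H' j hj
  have hmir : f.mirror = fourTerm (m - n) (m - 1) m 1 1 1 (-1) :=
    mirror_fourTerm one_pos hn1 hnm (by norm_num) one_ne_zero
  have hneg : ∀ a b (u s t w : ℤ),
      -fourTerm a b m u s t w = fourTerm a b m (-u) (-s) (-t) (-w) := by
    intro a b u s t w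
    simp only [fourTerm, map_neg]
    ring
  obtain ⟨hst, hsw | hsu⟩ := middle_signs_eq hu hs ht hw huw hone
  all_goals subst hst
  · subst hsw
    obtain ⟨rfl, rfl⟩ := exponents_eq_of_differences hn hm ha hab hbm fun j hj hjm => by
      rw [H'' j hj hjm, ← sq, hs, huw]
    rcases Int.eq_one_or_neg_one_of_sq_eq_one hs with rfl | rfl
    · obtain rfl : u = -1 := by linarith
      exact Or.inl hk
    · obtain rfl : u = 1 := by linarith
      exact Or.inr (Or.inl (by rw [hk, hf, hneg, neg_neg]))
  · subst hsu
    obtain ⟨h1, h2⟩ := exponents_eq_of_differences hn hm (a := m - b) (b := m - a) (by omega)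
      (by omega) (by omega) fun j hj hjm => by
        rw [H'' j hj hjm, ← sq, hs, huw, show m - a - (m - b) = b - a by omega,
          show m - (m - b) = b by omega, show m - (m - a) = a by omega]
        ring
    rw [show a = m - n by omega, show b = m - 1 by omega] at hk
    rcases Int.eq_one_or_neg_one_of_sq_eq_one hs with rfl | rfl
    · obtain rfl : w = -1 := by linarith
      exact Or.inr (Or.inr (Or.inl (by rw [hk, hmir])))
    · obtain rfl : w = 1 := by linarith
      exact Or.inr (Or.inr (Or.inr (by rw [hk, hmir, hneg, neg_neg])))

/-- If `z` and `z⁻¹` are roots of `-1 + X + X ^ n + X ^ m`, then `z` is a root of unity. -/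
theorem exists_pow_eq_one_of_aeval_quad_eq_zero {n m : ℕ} (hn : 0 < n) (hm : 0 < m) {z : ℂ}
    (hz : z ≠ 0) (h : aeval z (quad n m) = 0) (h' : aeval z⁻¹ (quad n m) = 0) :
    ∃ k : ℕ, 0 < k ∧ z ^ k = 1 := by
  simp only [quad, map_add, map_neg, map_one, aeval_X, map_pow] at h h'
  have hn0 : z ^ n ≠ 0 := pow_ne_zero _ hz
  have hm0 : z ^ m ≠ 0 := pow_ne_zero _ hz
  rw [inv_pow, inv_pow] at h'
  generalize hx : z ^ n = x at *
  generalize hy : z ^ m = y at *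
  have h2 : x * y + z * y + z * x - z * x * y = 0 := by
    have : z * x * y * (-1 + z⁻¹ + x⁻¹ + y⁻¹) = 0 := by rw [h', mul_zero]
    field_simp at this
    linear_combination this
  have key : (z - 1) * (x - 1) * (y - 1) = 0 := by
    linear_combination h - h2
  rcases mul_eq_zero.mp key with key | key
  · rcases mul_eq_zero.mp key with key | key
    · exact ⟨1, one_pos, by linear_combination key⟩
    · exact ⟨n, hn, by linear_combination hx + key⟩
  · exact ⟨m, hm, by linear_combination hy + key⟩

theorem aeval_reverse_eq_zero_iff {R : Type*} [CommRing R] [Algebra R ℂ] {p : R[X]} {z : ℂ}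
    (hz : z ≠ 0) : aeval z p.reverse = 0 ↔ aeval z⁻¹ p = 0 := by
  let : Invertible z⁻¹ := invertibleOfNonzero (inv_ne_zero hz)
  have := eval₂_reverse_eq_zero_iff (algebraMap R ℂ) z⁻¹ p
  rwa [invOf_eq_inv, inv_inv] at this

theorem aeval_inv_eq_zero_of_mirror {p : ℤ[X]} {z : ℂ} (hz : z ≠ 0)
    (hp : p.mirror = p ∨ p.mirror = -p) (h : aeval z p = 0) : aeval z⁻¹ p = 0 := by
  refine (aeval_reverse_eq_zero_iff hz).mp ?_
  have hm : aeval z p.mirror = 0 := by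
    rcases hp with hp | hp <;> simp [hp, h]
  rw [mirror, map_mul, map_pow, aeval_X] at hm
  exact (mul_eq_zero.mp hm).resolve_right (pow_ne_zero _ hz)

/-- A monic rational polynomial all of whose complex roots are roots of unity is a product of
cyclotomic polynomials. -/
theorem exists_eq_prod_cyclotomic {A : ℚ[X]} (hA : A.Monic)
    (h : ∀ z : ℂ, aeval z A = 0 → ∃ k : ℕ, 0 < k ∧ z ^ k = 1) :
    ∃ l : Multiset ℕ, (∀ k ∈ l, 0 < k) ∧ A = (l.map (fun k => cyclotomic k ℚ)).prod := by
  induction hd : A.natDegree using Nat.strong_induction_on generalizing A with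
  | _ d ih =>
    rcases Nat.eq_zero_or_pos d with rfl | hpos
    · exact ⟨0, by simp, by simpa using hA.natDegree_eq_zero.mp hd⟩
    obtain ⟨z, hz⟩ := IsAlgClosed.exists_aeval_eq_zero ℂ A
      (by rw [degree_eq_natDegree hA.ne_zero]; exact_mod_cast (by omega : A.natDegree ≠ 0))
    obtain ⟨k, hk, hzk⟩ := h z hz
    have hord : 0 < orderOf z := orderOf_pos_iff.mpr (isOfFinOrder_iff_pow_eq_one.mpr ⟨k, hk, hzk⟩)
    have hdvd : cyclotomic (orderOf z) ℚ ∣ A := by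
      rw [cyclotomic_eq_minpoly_rat (IsPrimitiveRoot.orderOf z) hord]
      exact minpoly.dvd ℚ z hz
    obtain ⟨q, rfl⟩ := hdvd
    have hq : q.Monic := (cyclotomic.monic _ ℚ).of_mul_monic_left hA
    have hcd : 0 < (cyclotomic (orderOf z) ℚ).natDegree := by
      rw [natDegree_cyclotomic]
      exact Nat.totient_pos.mpr hord
    rw [(cyclotomic.monic _ ℚ).natDegree_mul hq] at hd
    obtain ⟨l, hl, hql⟩ := ih q.natDegree (by omega) hq
      (fun y hy => h y (by rw [map_mul, hy, mul_zero])) rfl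
    refine ⟨orderOf z ::ₘ l, ?_, ?_⟩
    · intro i hi
      rcases Multiset.mem_cons.mp hi with rfl | hi
      · exact hord
      · exact hl i hi
    · rw [Multiset.map_cons, Multiset.prod_cons, ← hql]

theorem reverse_cyclotomic {k : ℕ} (hk : 1 < k) : (cyclotomic k ℚ).reverse = cyclotomic k ℚ := by
  have hc0 : (cyclotomic k ℚ).coeff 0 = 1 := cyclotomic_coeff_zero ℚ hk
  have hz : IsPrimitiveRoot _ k := Complex.isPrimitiveRoot_exp k (by omega)
  have htr : (cyclotomic k ℚ).natTrailingDegree = 0 :=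
    natTrailingDegree_eq_zero.mpr (Or.inr (by rw [hc0]; exact one_ne_zero))
  have hmonic : (cyclotomic k ℚ).reverse.Monic := by
    rw [Monic, reverse_leadingCoeff, trailingCoeff, htr, hc0]
  have hdvd : cyclotomic k ℚ ∣ (cyclotomic k ℚ).reverse := by
    conv_lhs => rw [cyclotomic_eq_minpoly_rat hz (by omega)]
    refine minpoly.dvd ℚ _ ((aeval_reverse_eq_zero_iff (hz.ne_zero (by omega))).mpr ?_)
    rw [cyclotomic_eq_minpoly_rat hz.inv (by omega)]
    exact minpoly.aeval ℚ _
  exact eq_of_monic_of_dvd_of_natDegree_le (cyclotomic.monic k ℚ) hmonic hdvd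
    (reverse_natDegree_le _)

theorem reverse_prod_cyclotomic {l : Multiset ℕ} (hl : ∀ k ∈ l, 1 < k) :
    (l.map (fun k => cyclotomic k ℚ)).prod.reverse = (l.map (fun k => cyclotomic k ℚ)).prod := by
  induction l using Multiset.induction with
  | empty => simpa using reverse_C (1 : ℚ)
  | cons k l ih =>
    rw [Multiset.map_cons, Multiset.prod_cons, reverse_mul_of_domain,
      reverse_cyclotomic (hl k (by simp)), ih fun i hi => hl i (Multiset.mem_cons_of_mem hi)]

theorem map_fourTerm_eq_quad (n m : ℕ) :
    (fourTerm 1 n m (-1) 1 1 1).map (algebraMap ℤ ℚ) = quad n m := by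
  simp [fourTerm, quad, ← C_mul_X_pow_eq_monomial]

theorem exists_map_eq_of_monic_dvd {f : ℤ[X]} (hf : f.Monic) {g : ℚ[X]} (hg : g.Monic)
    (h : g ∣ f.map (algebraMap ℤ ℚ)) : ∃ g' : ℤ[X], g'.map (algebraMap ℤ ℚ) = g := by
  obtain ⟨g', hg'⟩ := IsIntegrallyClosed.eq_map_mul_C_of_dvd ℚ hf h
  exact ⟨g', by simpa [hg.leadingCoeff] using hg'⟩

/-- In every factorization of the quadrinomial over `ℤ`, one of the factors is reciprocal up to
sign. -/
theorem mirror_eq_or_mirror_eq_of_mul_eq {n m : ℕ} (hn : 3 ≤ n) (hm : n + (n - 1) ≤ m)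
    {p q : ℤ[X]} (h : p * q = fourTerm 1 n m (-1) 1 1 1) :
    (p.mirror = p ∨ p.mirror = -p) ∨ (q.mirror = q ∨ q.mirror = -q) := by
  have hne : p * q ≠ 0 := by
    rw [h]
    intro h0
    have := natDegree_fourTerm (u := -1) (s := 1) (t := 1) one_pos (show 1 < n by omega)
      (show n < m by omega) (one_ne_zero (α := ℤ))
    rw [h0, natDegree_zero] at this
    omega
  have hp : p ≠ 0 := left_ne_zero_of_mul hne
  have hq : q.mirror ≠ 0 := mt mirror_eq_zero.mp (right_ne_zero_of_mul hne)
  have hk := eq_of_fourTerm_mul_mirror_eq hn hm (k := p * q.mirror) (by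
    rw [← h, mirror_mul_of_domain, mirror_mul_of_domain, mirror_mirror]
    ring)
  rw [← h, mirror_mul_of_domain, ← mul_neg, ← neg_mul] at hk
  rcases hk with hk | hk | hk | hk
  · exact Or.inr (Or.inl (mul_left_cancel₀ hp hk))
  · exact Or.inr (Or.inr (mul_left_cancel₀ hp hk))
  · exact Or.inl (Or.inl (mul_right_cancel₀ hq hk).symm)
  · exact Or.inl (Or.inr (neg_eq_iff_eq_neg.mp (mul_right_cancel₀ hq hk).symm))

/-- **Mills.** Write the quadrinomial `f = -1 + x + x^n + x^{m₁} ∈ B` as `f = A·B`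
where every root of `A` and no root of `B` is a root of unity (with `A` monic). Then
`A` is the greatest common divisor of `f` and `f*`, `A` is reciprocal and a product
of cyclotomic polynomials, and `B` is irreducible and nonreciprocal except when
`f = -1 + x + x^7 + x^8`, in which case
`-1 + x + x^7 + x^8 = (x^2+1)(x^3+x^2-1)(x^3-x+1)` with both cubic factors
irreducible and nonreciprocal. -/
theorem mills_quadrinomial (n m : ℕ) (hn : 3 ≤ n) (hm : n + (n - 1) ≤ m)
    (A B : Polynomial ℚ) (hAmonic : A.Monic)
    (hf : quad n m = A * B)
    (hA : ∀ z : ℂ, aeval z A = 0 → ∃ k : ℕ, 0 < k ∧ z ^ k = 1)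
    (hB : ∀ z : ℂ, aeval z B = 0 → ¬ ∃ k : ℕ, 0 < k ∧ z ^ k = 1) :
    (A ∣ quad n m ∧ A ∣ (quad n m).reverse ∧
      ∀ d : Polynomial ℚ, d ∣ quad n m → d ∣ (quad n m).reverse → d ∣ A) ∧
    A.reverse = A ∧
    (∃ l : Multiset ℕ, (∀ k ∈ l, 0 < k) ∧
      A = (l.map (fun k => cyclotomic k ℚ)).prod) ∧
    (¬ (n = 7 ∧ m = 8) → Irreducible B ∧ B.reverse ≠ B) ∧
    ((n = 7 ∧ m = 8) →
      quad n m = (X ^ 2 + 1) * (X ^ 3 + X ^ 2 - 1) * (X ^ 3 - X + 1) ∧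
      Irreducible (X ^ 3 + X ^ 2 - 1 : Polynomial ℚ) ∧
      (X ^ 3 + X ^ 2 - 1 : Polynomial ℚ).reverse ≠ X ^ 3 + X ^ 2 - 1 ∧
      Irreducible (X ^ 3 - X + 1 : Polynomial ℚ) ∧
      (X ^ 3 - X + 1 : Polynomial ℚ).reverse ≠ X ^ 3 - X + 1) := by
  have hmap := map_fourTerm_eq_quad n m
  have hfd : (fourTerm 1 n m (-1) 1 1 1).natDegree = m :=
    natDegree_fourTerm one_pos (by omega) (by omega) one_ne_zero
  have hfm : (fourTerm 1 n m (-1) 1 1 1).Monic := by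
    rw [Monic, leadingCoeff, hfd]
    simp [coeff_fourTerm, show 1 ≠ m by omega, show n ≠ m by omega,
      show 0 ≠ m by omega]
  have hqm : (quad n m).Monic := hmap ▸ hfm.map _
  have hq0 : (quad n m).coeff 0 = -1 := by
    rw [← hmap, coeff_map, coeff_zero_fourTerm one_pos (by omega) (by omega)]
    simp
  have hBmonic : B.Monic := hAmonic.of_mul_monic_left (hf ▸ hqm)
  have hz0 : ∀ {z : ℂ}, aeval z (quad n m) = 0 → z ≠ 0 := by
    rintro z hz rfl
    rw [← coeff_zero_eq_aeval_zero', hq0] at hz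
    norm_num at hz
  have hBq : ∀ {z : ℂ}, aeval z B = 0 → aeval z (quad n m) = 0 := fun hz => by
    rw [hf, map_mul, hz, mul_zero]
  obtain ⟨l, hl, hAl⟩ := exists_eq_prod_cyclotomic hAmonic hA
  have hl1 : ∀ k ∈ l, 1 < k := by
    intro k hk
    refine lt_of_le_of_ne (hl k hk) ?_
    rintro rfl
    have hdvd : cyclotomic 1 ℚ ∣ quad n m := by
      rw [hf, hAl]
      exact (Multiset.dvd_prod (Multiset.mem_map_of_mem (fun k => cyclotomic k ℚ) hk)).mul_right B
    rw [cyclotomic_one, ← C_1, dvd_iff_isRoot] at hdvd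
    norm_num [quad] at hdvd
  have hArev : A.reverse = A := by rw [hAl, reverse_prod_cyclotomic hl1]
  have hqrev : (quad n m).reverse ≠ quad n m := by
    intro h
    have := congrArg (coeff · 0) h
    simp only [coeff_zero_reverse, hqm.leadingCoeff, hq0] at this
    norm_num at this
  have hBrev : B.reverse ≠ B := by
    intro h
    apply hqrev
    rw [hf, reverse_mul_of_domain, hArev, h]
  have no_recip : ∀ {z : ℂ}, aeval z B = 0 → aeval z⁻¹ (quad n m) ≠ 0 := fun hz hz' =>
    hB _ hz (exists_pow_eq_one_of_aeval_quad_eq_zero (by omega) (by omega) (hz0 (hBq hz))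
      (hBq hz) hz')
  refine ⟨⟨hf ▸ dvd_mul_right A B, ?_, ?_⟩, hArev, ⟨l, hl, hAl⟩, fun _ => ⟨?_, hBrev⟩,
    fun h => by omega⟩
  · rw [hf, reverse_mul_of_domain, hArev]
    exact dvd_mul_right _ _
  · intro d hd hdr
    refine IsCoprime.dvd_of_dvd_mul_right (z := B) ?_ (hf ▸ hd)
    rw [isCoprime_iff_aeval_ne_zero_of_isAlgClosed ℚ ℂ]
    intro z
    by_contra! hz
    exact no_recip hz.2 ((aeval_reverse_eq_zero_iff (hz0 (hBq hz.2))).mp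
      (aeval_eq_zero_of_dvd_aeval_eq_zero hdr hz.1))
  · rw [hBmonic.irreducible_iff_natDegree]
    refine ⟨?_, fun G D hG hD hGD => ?_⟩
    · rintro rfl
      exact hBrev (by simpa using reverse_C (1 : ℚ))
    by_contra! hdeg
    have hfac : A * G * D = quad n m := by rw [hf, ← hGD, mul_assoc]
    have hAGq : A * G ∣ quad n m := hfac ▸ dvd_mul_right _ _
    have hDq : D ∣ quad n m := hfac ▸ dvd_mul_left _ _
    obtain ⟨p, hp⟩ := exists_map_eq_of_monic_dvd hfm (hAmonic.mul hG) (hmap ▸ hAGq)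
    obtain ⟨q, hq⟩ := exists_map_eq_of_monic_dvd hfm hD (hmap ▸ hDq)
    have hpq : p * q = fourTerm 1 n m (-1) 1 1 1 := by
      apply map_injective (algebraMap ℤ ℚ) (algebraMap ℤ ℚ).injective_int
      rw [Polynomial.map_mul, hp, hq, hfac, hmap]
    have recip : ∀ {r : ℤ[X]} {H R : ℚ[X]}, (r.mirror = r ∨ r.mirror = -r) →
        r.map (algebraMap ℤ ℚ) = R → R ∣ quad n m → H ∣ R → H ∣ B → H.Monic →
        H.natDegree = 0 := by
      intro r H R hr hrR hRq hHR hHB hH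
      by_contra hHd
      obtain ⟨z, hz⟩ := IsAlgClosed.exists_aeval_eq_zero ℂ H
        (by rw [degree_eq_natDegree hH.ne_zero]; exact_mod_cast hHd)
      have hzB : aeval z B = 0 := aeval_eq_zero_of_dvd_aeval_eq_zero hHB hz
      have hzR : aeval z R = 0 := aeval_eq_zero_of_dvd_aeval_eq_zero hHR hz
      rw [← hrR, aeval_map_algebraMap] at hzR
      have hzr := aeval_inv_eq_zero_of_mirror (hz0 (hBq hzB)) hr hzR
      rw [← aeval_map_algebraMap ℚ, hrR] at hzr
      exact no_recip hzB (aeval_eq_zero_of_dvd_aeval_eq_zero hRq hzr)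
    rcases mirror_eq_or_mirror_eq_of_mul_eq hn hm hpq with h | h
    · exact hdeg.1 (recip h hp hAGq (dvd_mul_left G A) (hGD ▸ dvd_mul_right _ _) hG)
    · exact hdeg.2 (recip h hq hDq dvd_rfl (hGD ▸ dvd_mul_left _ _) hD)
end

section
/- Let n ≥ 3 and let f(x) = -1 + x + x^n + x^{m_1} + ... + x^{m_s} belong to B_n with s ≥ 1, factored as f = A·B·C where A is the product of the irreducible cyclotomic factors, B the product of the irreducible reciprocal noncyclotomic factors, and C the nonreciprocal part. Then f has exactly one positive real root, and this root is a root of the nonreciprocal part C (in particular it is not a root of A or of B). -/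
open Polynomial

/-- The polynomial `f(x) = -1 + x + x^n + x^{m 0} + ⋯ + x^{m (s-1)}` of the class `B_n`. -/
noncomputable def fB (n s : ℕ) (m : ℕ → ℕ) : Polynomial ℤ :=
  -1 + X + X ^ n + ∑ q ∈ Finset.range s, X ^ m q

/-- `A` is a product of cyclotomic polynomials. -/
def IsCyclotomicProduct (A : Polynomial ℤ) : Prop :=
  ∃ l : Multiset ℕ, (∀ k ∈ l, 0 < k) ∧ A = (l.map (fun k => cyclotomic k ℤ)).prod

/-- `B` is a product of irreducible reciprocal noncyclotomic polynomials. -/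
def IsReciprocalNoncyclotomicProduct (B : Polynomial ℤ) : Prop :=
  ∃ l : Multiset (Polynomial ℤ),
    (∀ p ∈ l, Irreducible p ∧ p.reverse = p ∧ ∀ k : ℕ, p ≠ cyclotomic k ℤ) ∧ B = l.prod

/-- `C` is a product of irreducible nonreciprocal polynomials. -/
def IsNonreciprocalProduct (C : Polynomial ℤ) : Prop :=
  ∃ l : Multiset (Polynomial ℤ),
    (∀ p ∈ l, Irreducible p ∧ p.reverse ≠ p) ∧ C = l.prod

theorem aeval_fB (n s : ℕ) (m : ℕ → ℕ) (x : ℝ) :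
    aeval x (fB n s m) = -1 + x + x ^ n + ∑ q ∈ Finset.range s, x ^ m q := by
  simp [fB]

theorem aeval_fB_lt {n s : ℕ} {m : ℕ → ℕ} {x y : ℝ} (hx : 0 ≤ x) (hxy : x < y) :
    aeval x (fB n s m) < aeval y (fB n s m) := by
  rw [aeval_fB, aeval_fB]
  have hsum : ∑ q ∈ Finset.range s, x ^ m q ≤ ∑ q ∈ Finset.range s, y ^ m q :=
    Finset.sum_le_sum fun q _ => pow_le_pow_left₀ hx hxy.le _
  have hpow : x ^ n ≤ y ^ n := pow_le_pow_left₀ hx hxy.le _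
  linarith

theorem aeval_fB_zero {n s : ℕ} {m : ℕ → ℕ} (hn : n ≠ 0) (hm : ∀ q < s, m q ≠ 0) :
    aeval (0 : ℝ) (fB n s m) = -1 := by
  rw [aeval_fB, Finset.sum_eq_zero fun q hq => zero_pow (hm q (Finset.mem_range.mp hq)),
    zero_pow hn]
  norm_num

theorem aeval_fB_one_pos (n s : ℕ) (m : ℕ → ℕ) : 0 < aeval (1 : ℝ) (fB n s m) := by
  rw [aeval_fB]
  simp only [one_pow, Finset.sum_const, Finset.card_range, nsmul_eq_mul, mul_one]
  positivity

theorem existsUnique_pos_root_fB {n s : ℕ} {m : ℕ → ℕ} (hn : n ≠ 0) (hm : ∀ q < s, m q ≠ 0) :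
    ∃! x : ℝ, 0 < x ∧ aeval x (fB n s m) = 0 := by
  have hcont : ContinuousOn (fun x : ℝ => aeval x (fB n s m)) (Set.Icc 0 1) :=
    (fB n s m).continuous_aeval.continuousOn
  have h0 := aeval_fB_zero hn hm
  obtain ⟨x, hx, hfx⟩ := intermediate_value_Icc zero_le_one hcont
    (show (0 : ℝ) ∈ Set.Icc _ _ from ⟨by rw [h0]; norm_num, (aeval_fB_one_pos n s m).le⟩)
  have hfx : aeval x (fB n s m) = 0 := hfx
  have hpos : 0 < x := by
    rcases hx.1.eq_or_lt with h | h
    · rw [← h, h0] at hfx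
      norm_num at hfx
    · exact h
  refine ⟨x, ⟨hpos, hfx⟩, fun y ⟨hy, hfy⟩ => ?_⟩
  rcases lt_trichotomy y x with h | h | h
  · have := aeval_fB_lt (n := n) (s := s) (m := m) hy.le h
    linarith
  · exact h
  · have := aeval_fB_lt (n := n) (s := s) (m := m) hpos.le h
    linarith

theorem pos_root_fB_lt_one {n s : ℕ} {m : ℕ → ℕ} {x : ℝ} (h : aeval x (fB n s m) = 0) :
    x < 1 := by
  by_contra! hx
  have h1 := aeval_fB_one_pos n s m
  rcases hx.eq_or_lt with h' | h'
  · rw [h'] at h1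
    exact h1.ne' h
  · have := aeval_fB_lt (n := n) (s := s) (m := m) zero_le_one h'
    linarith

theorem IsCyclotomicProduct.aeval_ne_zero {A : ℤ[X]} (hA : IsCyclotomicProduct A) {x : ℝ}
    (hx : 0 < x) (hx1 : x < 1) : aeval x A ≠ 0 := by
  obtain ⟨l, hl, rfl⟩ := hA
  rw [map_multiset_prod, Multiset.map_map]
  refine Multiset.prod_ne_zero fun h => ?_
  obtain ⟨k, hk, hk0⟩ := Multiset.mem_map.mp h
  obtain ⟨g, hg⟩ := cyclotomic.dvd_X_pow_sub_one k ℤ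
  have hxk := congrArg (aeval x) hg
  rw [map_mul, show aeval x (cyclotomic k ℤ) = 0 from hk0, zero_mul] at hxk
  simp only [map_sub, map_pow, aeval_X, map_one] at hxk
  have := pow_lt_one₀ hx.le hx1 (hl k hk).ne'
  linarith

theorem IsReciprocalNoncyclotomicProduct.aeval_inv_eq_zero {B : ℤ[X]}
    (hB : IsReciprocalNoncyclotomicProduct B) {x : ℝ} (hx : aeval x B = 0) :
    aeval x⁻¹ B = 0 := by
  obtain ⟨l, hl, rfl⟩ := hB
  rw [map_multiset_prod] at hx ⊢
  obtain ⟨p, hp, hpx⟩ := Multiset.mem_map.mp (Multiset.prod_eq_zero_iff.mp hx)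
  refine Multiset.prod_eq_zero (Multiset.mem_map.mpr ⟨p, hp, ?_⟩)
  rcases eq_or_ne x 0 with rfl | hx0
  · rwa [inv_zero]
  let := invertibleOfNonzero hx0
  have h := eval₂_reverse_eq_zero_iff (algebraMap ℤ ℝ) x p
  rw [(hl p hp).2.1, invOf_eq_inv] at h
  exact h.mpr hpx

/-- **Proposition (Descartes' rule application).** Let `f ∈ B_n` (`n ≥ 3`, `s ≥ 1`)
be factored as `f = A·B·C` with `A` the cyclotomic part, `B` the reciprocal
noncyclotomic part and `C` the nonreciprocal part. Then `f` has exactly one positive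
real root, and this root is a root of `C` (and not of `A` nor of `B`). -/
theorem positive_root_of_nonreciprocal_part (n s : ℕ) (m : ℕ → ℕ)
    (hn : 3 ≤ n) (hs : 1 ≤ s)
    (hm1 : n + (n - 1) ≤ m 0)
    (hmq : ∀ q, q + 1 < s → m q + (n - 1) ≤ m (q + 1))
    (A B C : Polynomial ℤ)
    (hA : IsCyclotomicProduct A)
    (hB : IsReciprocalNoncyclotomicProduct B)
    (hC : IsNonreciprocalProduct C)
    (hf : fB n s m = A * B * C) :
    (∃! x : ℝ, 0 < x ∧ aeval x (fB n s m) = 0) ∧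
    ∀ x : ℝ, 0 < x → aeval x (fB n s m) = 0 →
      aeval x C = 0 ∧ aeval x A ≠ 0 ∧ aeval x B ≠ 0 := by
  have hm : ∀ q < s, m q ≠ 0 := by
    intro q hq
    induction q with
    | zero => omega
    | succ q ih =>
      have := hmq q hq
      omega
  refine ⟨existsUnique_pos_root_fB (by omega) hm, fun x hx hfx => ?_⟩
  have hx1 := pos_root_fB_lt_one hfx
  have hAx := hA.aeval_ne_zero hx hx1
  have hBx : aeval x B ≠ 0 := fun h => by
    have hinv : aeval x⁻¹ (fB n s m) = 0 := by
      rw [hf, map_mul, map_mul, hB.aeval_inv_eq_zero h, mul_zero, zero_mul]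
    exact (one_lt_inv_iff₀.mpr ⟨hx, hx1⟩).not_gt (pos_root_fB_lt_one hinv)
  rw [hf, map_mul, map_mul] at hfx
  exact ⟨(mul_eq_zero.mp hfx).resolve_left (mul_ne_zero hAx hBx), hAx, hBx⟩
end

section
/- Let f(x) = -1 + x + x^n + x^{m_1} + ... + x^{m_s} belong to the class B with n ≥ 2 and s ≥ 1, and suppose f is divisible by some cyclotomic polynomial. Then there exists a positive integer m, all of whose prime factors are at most s + 3, such that the cyclotomic polynomial Φ_m(x) divides f(x). -/
open Polynomial

/-- Orthogonality of characters of `ℤ/p`, applied to a sum of monomials. -/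
lemma IsPrimitiveRoot.sum_pow_mul_sum_monomials {p : ℕ} {ω : ℂ}
    (hω : IsPrimitiveRoot ω p) (S : Finset ℕ) (c : ℕ → ℂ) (d : ℕ → ℕ) (t : ℕ) (x : ℂ) :
    ∑ i ∈ Finset.range p, (ω ^ i) ^ t * ∑ j ∈ S, c j * (x * ω ^ i) ^ d j =
      p * ∑ j ∈ S with p ∣ d j + t, c j * x ^ d j := by
  have key (a : ℕ) : ∑ i ∈ Finset.range p, (ω ^ a) ^ i = if p ∣ a then (p : ℂ) else 0 := by
    split_ifs with h
    · simp [(hω.pow_eq_one_iff_dvd a).2 h]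
    · have h1 : ω ^ a - 1 ≠ 0 := fun h0 => h ((hω.pow_eq_one_iff_dvd a).1 (sub_eq_zero.1 h0))
      refine (mul_eq_zero.1 ?_).resolve_left h1
      rw [mul_geom_sum, ← pow_mul, mul_comm, pow_mul, hω.pow_eq_one, one_pow, sub_self]
  simp_rw [Finset.mul_sum]
  rw [Finset.sum_comm, Finset.sum_filter]
  refine Finset.sum_congr rfl fun j _ => ?_
  have : ∀ i ∈ Finset.range p, (ω ^ i) ^ t * (c j * (x * ω ^ i) ^ d j) =
      c j * x ^ d j * (ω ^ (d j + t)) ^ i := fun i _ => by ring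
  rw [Finset.sum_congr rfl this, ← Finset.mul_sum, key]
  split_ifs <;> ring

lemma IsPrimitiveRoot.of_pow_prime {p M : ℕ} (hp : p.Prime) (hpM : p ∣ M) {x : ℂ}
    (hx : IsPrimitiveRoot (x ^ p) M) : IsPrimitiveRoot x (p * M) := by
  have hM : orderOf (x ^ p) = M := hx.eq_orderOf.symm
  have h := orderOf_pow' x hp.ne_zero
  rw [hM] at h
  rw [IsPrimitiveRoot.iff_orderOf]
  rcases (Nat.dvd_prime hp).1 (Nat.gcd_dvd_right (orderOf x) p) with h1 | h1
  · rw [h1, Nat.div_one] at h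
    rw [← h, Nat.gcd_eq_right hpM] at h1
    exact absurd h1 hp.ne_one
  · have hd : p ∣ orderOf x := h1 ▸ Nat.gcd_dvd_left (orderOf x) p
    rw [h, h1, Nat.mul_div_cancel' hd]

lemma exists_forall_not_dvd_add {p : ℕ} (hp : p.Prime) (S : Finset ℕ) (hS : S.card < p)
    (d : ℕ → ℕ) : ∃ t, ∀ j ∈ S, ¬ p ∣ d j + t := by
  have : NeZero p := ⟨hp.ne_zero⟩
  obtain ⟨u, hu⟩ : ∃ u : ZMod p, u ∉ S.image fun j => -(d j : ZMod p) := by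
    by_contra! h
    have h1 : (S.image fun j => -(d j : ZMod p)) = Finset.univ := Finset.eq_univ_of_forall h
    have h2 : (S.image fun j => -(d j : ZMod p)).card ≤ S.card := Finset.card_image_le
    rw [h1, Finset.card_univ, ZMod.card] at h2
    omega
  refine ⟨u.val, fun j hj hd => hu (Finset.mem_image.2 ⟨j, hj, ?_⟩)⟩
  rw [← ZMod.natCast_eq_zero_iff] at hd
  push_cast at hd
  rw [ZMod.natCast_zmod_val] at hd
  exact neg_eq_of_add_eq_zero_right hd

/-- A sum of fewer than `p` monomials vanishing at all primitive roots of unity of order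
`p ^ (e + 1) * l`, with `l` prime to `p`, vanishes at all primitive `l`-th roots of unity. -/
lemma sum_monomials_eq_zero_of_primitiveRoots {p l : ℕ} (hp : p.Prime) (hpl : ¬ p ∣ l) (e : ℕ)
    (S : Finset ℕ) (hS : S.card < p) (c : ℕ → ℂ) (d : ℕ → ℕ)
    (h : ∀ ζ : ℂ, IsPrimitiveRoot ζ (p ^ (e + 1) * l) → ∑ j ∈ S, c j * ζ ^ d j = 0)
    (η : ℂ) (hη : IsPrimitiveRoot η l) : ∑ j ∈ S, c j * η ^ d j = 0 := by
  have hω := Complex.isPrimitiveRoot_exp p hp.ne_zero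
  set ω := Complex.exp (2 * Real.pi * Complex.I / p)
  have hp0 : (p : ℂ) ≠ 0 := Nat.cast_ne_zero.2 hp.ne_zero
  induction e generalizing S d η with
  | zero =>
    obtain ⟨t, ht⟩ := exists_forall_not_dvd_add hp S hS d
    have key := hω.sum_pow_mul_sum_monomials S c d t η
    rw [Finset.filter_false_of_mem ht, Finset.sum_empty, mul_zero,
      Finset.sum_eq_single_of_mem 0 (Finset.mem_range.2 hp.pos)] at key
    · simpa using key
    · intro i hi hi0
      have hcop : Nat.Coprime i p :=
        ((Nat.Prime.coprime_iff_not_dvd hp).2 fun hd =>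
          (Nat.le_of_dvd (Nat.pos_of_ne_zero hi0) hd).not_gt (Finset.mem_range.1 hi)).symm
      have h1 := hω.pow_of_coprime i hcop
      have h2 : IsPrimitiveRoot (η * ω ^ i) (p ^ (0 + 1) * l) := by
        rw [IsPrimitiveRoot.iff_orderOf, (Commute.all η (ω ^ i)).orderOf_mul_eq_mul_orderOf_of_coprime,
          ← hη.eq_orderOf, ← h1.eq_orderOf]
        · ring
        · rw [← hη.eq_orderOf, ← h1.eq_orderOf]
          exact ((Nat.Prime.coprime_iff_not_dvd hp).2 hpl).symm
      rw [h _ h2, mul_zero]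
  | succ e ih =>
    have hmod : ∀ r ∈ Finset.range p, ∑ j ∈ S with d j % p = r, c j * η ^ d j = 0 := by
      intro r hr
      have hr := Finset.mem_range.1 hr
      have split (x : ℂ) : ∑ j ∈ S with d j % p = r, c j * x ^ d j =
          x ^ r * ∑ j ∈ S with d j % p = r, c j * (x ^ p) ^ (d j / p) := by
        rw [Finset.mul_sum]
        refine Finset.sum_congr rfl fun j hj => ?_
        have hj := (Finset.mem_filter.1 hj).2
        rw [← pow_mul, mul_left_comm, ← pow_add, ← hj, Nat.mod_add_div]
      rw [split, ih _ ((Finset.card_filter_le _ _).trans_lt hS) (fun j => d j / p) _ _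
        (hη.pow_of_coprime p ((Nat.Prime.coprime_iff_not_dvd hp).2 hpl)), mul_zero]
      intro ζ hζ
      obtain ⟨z, rfl⟩ := IsAlgClosed.exists_pow_nat_eq ζ hp.pos
      have hz (w : ℂ) (hw : w ^ p = z ^ p) : IsPrimitiveRoot w (p ^ (e + 1 + 1) * l) := by
        have := IsPrimitiveRoot.of_pow_prime hp
          (Dvd.dvd.mul_right (dvd_pow_self p e.succ_ne_zero) l) (hw ▸ hζ)
        rwa [← mul_assoc, ← pow_succ'] at this
      have hz0 : z ≠ 0 := by
        have hl : l ≠ 0 := by rintro rfl; simp at hpl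
        exact (hz z rfl).ne_zero (mul_ne_zero (pow_ne_zero _ hp.ne_zero) hl)
      have key := hω.sum_pow_mul_sum_monomials S c d (p - r) z
      rw [Finset.sum_eq_zero, eq_comm, mul_eq_zero, or_iff_right hp0] at key
      · have hfilter : (S.filter fun j => p ∣ d j + (p - r)) = S.filter fun j => d j % p = r := by
          refine Finset.filter_congr fun j _ => ?_
          have h1 : d j + (p - r) = d j + p - r := by omega
          rw [h1, ← Nat.modEq_iff_dvd' (by omega), Nat.ModEq, Nat.add_mod_right,
            Nat.mod_eq_of_lt hr, eq_comm]
        rw [hfilter, split] at key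
        exact (mul_eq_zero.1 key).resolve_left (pow_ne_zero _ hz0)
      · intro i _
        rw [h _ (hz _ _), mul_zero]
        rw [mul_pow, ← pow_mul, mul_comm i, pow_mul, hω.pow_eq_one, one_pow, mul_one]
    rw [← Finset.sum_fiberwise_of_maps_to (t := Finset.range p) (g := fun j => d j % p)
      fun j _ => Finset.mem_range.2 (Nat.mod_lt _ hp.pos)]
    exact Finset.sum_eq_zero hmod

lemma cyclotomic_int_dvd_iff {k : ℕ} (hk : 0 < k) (f : ℤ[X]) :
    cyclotomic k ℤ ∣ f ↔ ∀ ζ : ℂ, IsPrimitiveRoot ζ k → aeval ζ f = 0 := by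
  constructor
  · intro h ζ hζ
    refine aeval_eq_zero_of_dvd_aeval_eq_zero h ?_
    rw [cyclotomic_eq_minpoly hζ hk]
    exact minpoly.aeval ℤ ζ
  · intro h
    have hζ := Complex.isPrimitiveRoot_exp k hk.ne'
    rw [cyclotomic_eq_minpoly hζ hk]
    exact minpoly.isIntegrallyClosed_dvd (hζ.isIntegral hk) (h _ hζ)

lemma cyclotomic_dvd_of_card_support_lt {p l e : ℕ} (hp : p.Prime) (hpl : ¬ p ∣ l) {f : ℤ[X]}
    (hf : f.support.card < p) (h : cyclotomic (p ^ (e + 1) * l) ℤ ∣ f) :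
    cyclotomic l ℤ ∣ f := by
  have hl : 0 < l := Nat.pos_of_ne_zero (by rintro rfl; simp at hpl)
  have haeval (ζ : ℂ) : aeval ζ f = ∑ j ∈ f.support, (f.coeff j : ℂ) * ζ ^ j := by
    simp [aeval_def, eval₂_eq_sum, sum_def]
  rw [cyclotomic_int_dvd_iff (Nat.mul_pos (pow_pos hp.pos _) hl)] at h
  simp_rw [cyclotomic_int_dvd_iff hl, haeval] at h ⊢
  exact sum_monomials_eq_zero_of_primitiveRoots hp hpl e _ hf (fun j => f.coeff j) id h

lemma card_support_fB_le (n s : ℕ) (m : ℕ → ℕ) : (fB n s m).support.card ≤ s + 3 := by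
  have hsub : (fB n s m).support ⊆ {0, 1, n} ∪ (Finset.range s).image m := by
    intro a ha
    contrapose! ha
    simp only [Finset.mem_union, Finset.mem_insert, Finset.mem_singleton, Finset.mem_image,
      Finset.mem_range, not_or, not_exists, not_and] at ha
    obtain ⟨⟨h0, h1, hn⟩, hm⟩ := ha
    have hsum : ∑ q ∈ Finset.range s, (if a = m q then (1 : ℤ) else 0) = 0 :=
      Finset.sum_eq_zero fun q hq => if_neg fun h => hm q (Finset.mem_range.1 hq) h.symm
    simp [fB, coeff_X, coeff_X_pow, coeff_one, h0, hn, Ne.symm h1, hsum]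
  calc _ ≤ _ := Finset.card_le_card hsub
    _ ≤ _ := Finset.card_union_le _ _
    _ ≤ 3 + s := Nat.add_le_add Finset.card_le_three
        (Finset.card_image_le.trans (Finset.card_range s).le)
    _ = s + 3 := add_comm _ _

/-- **Lemma (Filaseta).** If `f ∈ B` (`n ≥ 2`, `s ≥ 1`) is divisible by some
cyclotomic polynomial, then there exists `M` all of whose prime factors are
`≤ s + 3` such that `Φ_M` divides `f`. -/
theorem cyclotomic_divisor_smooth (n s : ℕ) (m : ℕ → ℕ)
    (hn : 2 ≤ n) (hs : 1 ≤ s)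
    (hm1 : n + (n - 1) ≤ m 0)
    (hmq : ∀ q, q + 1 < s → m q + (n - 1) ≤ m (q + 1))
    (hdiv : ∃ k : ℕ, 0 < k ∧ cyclotomic k ℤ ∣ fB n s m) :
    ∃ M : ℕ, 0 < M ∧ (∀ p : ℕ, p.Prime → p ∣ M → p ≤ s + 3) ∧
      cyclotomic M ℤ ∣ fB n s m := by
  classical
  obtain ⟨hM, hMf⟩ := Nat.find_spec hdiv
  refine ⟨Nat.find hdiv, hM, fun p hp hpM => ?_, hMf⟩
  by_contra! hlt
  obtain ⟨e, l, hpl, heq⟩ := Nat.exists_eq_pow_mul_and_not_dvd hM.ne' p hp.ne_one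
  have hl : 0 < l := Nat.pos_of_ne_zero (by rintro rfl; simp at hpl)
  obtain _ | e := e
  · rw [heq, pow_zero, one_mul] at hpM
    exact hpl hpM
  · have hdvd := cyclotomic_dvd_of_card_support_lt hp hpl
      ((card_support_fB_le n s m).trans_lt hlt) (heq ▸ hMf)
    refine Nat.find_min hdiv ?_ ⟨hl, hdvd⟩
    rw [heq]
    exact lt_mul_left hl (Nat.one_lt_pow e.succ_ne_zero hp.one_lt)
end

section
/- Let p ≥ 3 be a prime number and let n ≥ 2. Then there exist infinitely many polynomials f in the class B_n (i.e., for every D there exists f ∈ B_n of degree greater than D) such that the cyclotomic polynomial Φ_p(x) divides f(x). -/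
open Polynomial

/-- The residues modulo `k + 1` completing `-1 + x + x ^ n` to a multiple of
`1 + x + ⋯ + x ^ k`: the exponent `0` cancels `-1`, and the next two blocks of length `k`
complete `x` and `x ^ n` respectively. -/
def complementExponent (n k q : ℕ) : ℕ :=
  if q = 0 then 0 else if q ≤ k then q + 1 else n + (q - k)

theorem sum_pow_complementExponent {R : Type*} [CommRing R] (n k : ℕ) (z : R)
    (hz : ∑ i ∈ Finset.range (k + 1), z ^ i = 0) :
    -1 + z + z ^ n + ∑ q ∈ Finset.range (1 + k + k), z ^ complementExponent n k q = 0 := by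
  rw [Finset.sum_range_add, Finset.sum_range_add, Finset.sum_range_one]
  have h₁ : ∑ i ∈ Finset.range k, z ^ complementExponent n k (1 + i) =
      z * ∑ i ∈ Finset.range k, z ^ (i + 1) := by
    rw [Finset.mul_sum]
    refine Finset.sum_congr rfl fun i hi => ?_
    have hi := Finset.mem_range.mp hi
    have : complementExponent n k (1 + i) = i + 1 + 1 := by
      unfold complementExponent
      split_ifs <;> omega
    rw [this, pow_succ' z (i + 1)]
  have h₂ : ∑ i ∈ Finset.range k, z ^ complementExponent n k (1 + k + i) =
      z ^ n * ∑ i ∈ Finset.range k, z ^ (i + 1) := by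
    rw [Finset.mul_sum]
    refine Finset.sum_congr rfl fun i hi => ?_
    have : complementExponent n k (1 + k + i) = n + (i + 1) := by
      unfold complementExponent
      split_ifs <;> omega
    rw [this, pow_add]
  have h₀ : complementExponent n k 0 = 0 := rfl
  rw [Finset.sum_range_succ'] at hz
  rw [h₁, h₂, h₀]
  linear_combination (z + z ^ n) * hz

theorem le_natDegree_fB (n s : ℕ) (m : ℕ → ℕ) (hs : 0 < s) (hm : 0 < m 0) :
    m 0 ≤ (fB n s m).natDegree := by
  apply le_natDegree_of_ne_zero
  have h : (1 : ℤ) ≤ ∑ q ∈ Finset.range s, (X ^ m q : ℤ[X]).coeff (m 0) := by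
    have := Finset.single_le_sum (f := fun q => (X ^ m q : ℤ[X]).coeff (m 0))
      (fun q _ => by simp only [coeff_X_pow]; split_ifs <;> norm_num)
      (Finset.mem_range.mpr hs)
    simpa using this
  have h₁ : (0 : ℤ) ≤ (X : ℤ[X]).coeff (m 0) := by
    rw [coeff_X]; split_ifs <;> norm_num
  have h₂ : (0 : ℤ) ≤ (X ^ n : ℤ[X]).coeff (m 0) := by
    rw [coeff_X_pow]; split_ifs <;> norm_num
  have h₃ : (1 : ℤ[X]).coeff (m 0) = 0 := by
    rw [coeff_one, if_neg hm.ne']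
  rw [fB, coeff_add, coeff_add, coeff_add, coeff_neg, finsetSum_coeff, h₃]
  omega

theorem cyclotomic_prime_dvd_fB (k n N : ℕ) (hp : (k + 1).Prime) :
    cyclotomic (k + 1) ℤ ∣
      fB n (1 + k + k) fun q => (k + 1) * (N * (q + 1)) + complementExponent n k q := by
  have := Fact.mk hp
  rw [← AdjoinRoot.mk_eq_zero]
  set z := AdjoinRoot.root (cyclotomic (k + 1) ℤ) with hz
  have hsum : ∑ i ∈ Finset.range (k + 1), z ^ i = 0 := by
    have h := congrArg (AdjoinRoot.mk (cyclotomic (k + 1) ℤ)) (cyclotomic_prime ℤ (k + 1))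
    rw [AdjoinRoot.mk_self] at h
    simpa [← hz] using h.symm
  have hpow : z ^ (k + 1) = 1 := by
    have h := mul_geom_sum z (k + 1)
    rw [hsum, mul_zero] at h
    exact (sub_eq_zero.mp h.symm)
  simpa [fB, pow_add _ ((k + 1) * _), pow_mul _ (k + 1), hpow, ← hz] using
    sum_pow_complementExponent n k z hsum

/-- **Proposition.** For every prime `p ≥ 3` and every `n ≥ 2`, there exist
infinitely many `f ∈ B_n` (i.e. of arbitrarily large degree) divisible by `Φ_p`. -/
theorem infinitely_many_cyclotomic_divisible (p : ℕ) (hp : p.Prime) (hp3 : 3 ≤ p)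
    (n : ℕ) (hn : 2 ≤ n) :
    ∀ D : ℕ, ∃ (s : ℕ) (m : ℕ → ℕ),
      (0 < s → n + (n - 1) ≤ m 0) ∧
      (∀ q, q + 1 < s → m q + (n - 1) ≤ m (q + 1)) ∧
      D < (fB n s m).natDegree ∧
      cyclotomic p ℤ ∣ fB n s m := by
  intro D
  obtain ⟨k, rfl⟩ : ∃ k, p = k + 1 := ⟨p - 1, by omega⟩
  have hN : 3 * (n + D + 1) ≤ (k + 1) * (n + D + 1) := Nat.mul_le_mul_right _ hp3
  refine ⟨1 + k + k, fun q => (k + 1) * ((n + D + 1) * (q + 1)) + complementExponent n k q,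
    fun _ => ?_, fun q hq => ?_, ?_, cyclotomic_prime_dvd_fB k n _ hp⟩
  · simp only [zero_add, mul_one]
    omega
  · have hr : complementExponent n k q ≤ complementExponent n k (q + 1) + (k + 1) := by
      simp only [complementExponent, Nat.add_one_ne_zero, if_false]
      split_ifs <;> omega
    dsimp only
    nlinarith [Nat.sub_le n 1, Nat.zero_le (k * D), Nat.zero_le (k * n)]
  · refine lt_of_lt_of_le ?_ (le_natDegree_fB n _ _ (by omega) ?_)
    · simp only [zero_add, mul_one]
      omega
    · positivity
end
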